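/- arXiv:1005.3045 — 2 statements merged into one kernel-verified Lean document; each statement's English description precedes it below -/
import Mathlib

section
/- If a finite group G acts on the finite game Γ, then for every m ∈ ℕ the set Δ^Π_{G×S_m}(Γ^{Πm}) of (G×S_m)-invariant product distributions of the m-th power is good in the zero-sum game (Γ^{⊗m})^0 associated to the contracted m-th power. -/
open Finset
open scoped Classical BigOperators

/-- Expected payoff of the maximizer in a finite two-player zero-sum game with
maximizer utility `u`, when the maximizer plays the mixed strategy `σ` and the
minimizer plays the mixed strategy `θ` (utilities extended by linearity). -/
noncomputable def expPay {A B : Type*} [Fintype A] [Fintype B] (u : A → B → ℝ)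
    (σ : A → ℝ) (θ : B → ℝ) : ℝ :=
  ∑ a, ∑ b, σ a * θ b * u a b

/-- The (minimax) value of the zero-sum game with maximizer utility `u`. -/
noncomputable def gameValue {A B : Type*} [Fintype A] [Fintype B] (u : A → B → ℝ) : ℝ :=
  ⨆ σ : stdSimplex ℝ A, ⨅ θ : stdSimplex ℝ B, expPay u σ.1 θ.1

/-- The maximin strategies: mixed strategies of the maximizer guaranteeing at least the
value of the game against every mixed strategy of the minimizer. -/
def maximin {A B : Type*} [Fintype A] [Fintype B] (u : A → B → ℝ) : Set (A → ℝ) :=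
  {σ | σ ∈ stdSimplex ℝ A ∧ ∀ θ ∈ stdSimplex ℝ B, gameValue u ≤ expPay u σ θ}

/-- `σ` is a good reply to `θ`: it gets at least the value of the game against `θ`. -/
def GoodReply {A B : Type*} [Fintype A] [Fintype B] (u : A → B → ℝ)
    (σ : A → ℝ) (θ : B → ℝ) : Prop :=
  gameValue u ≤ expPay u σ θ

/-- `S` is good against `T`: for every `θ ∈ T` some `σ ∈ S` is a good reply to `θ`. -/
def GoodAgainst {A B : Type*} [Fintype A] [Fintype B] (u : A → B → ℝ)
    (S : Set (A → ℝ)) (T : Set (B → ℝ)) : Prop :=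
  ∀ θ ∈ T, ∃ σ ∈ S, GoodReply u σ θ

/-- `S` is good: good against all mixed strategies of the minimizer. -/
def IsGood {A B : Type*} [Fintype A] [Fintype B] (u : A → B → ℝ)
    (S : Set (A → ℝ)) : Prop :=
  GoodAgainst u S (stdSimplex ℝ B)


/-- The maximizer's utility in the auxiliary zero-sum game `Γ⁰` associated to the finite
game with strategy sets `C i` and utilities `u`.  The maximizer plays a strategy profile
`s`, the minimizer a pair `(rᵢ, tᵢ)` of strategies of some player `i`. -/
noncomputable def uM0 {I : Type*} [Fintype I] {C : I → Type*} [∀ i, Fintype (C i)]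
    (u : ∀ i : I, (∀ j, C j) → ℝ) (s : ∀ j, C j) : (Σ i : I, C i × C i) → ℝ :=
  fun p => if p.2.1 = s p.1 then u p.1 s - u p.1 (Function.update s p.1 p.2.2) else 0

/-- Correlated equilibria of the finite game with strategy sets `C i` and utilities `u`:
distributions `π` on profiles such that no player can gain by deviating from a
recommended strategy `sᵢ` to any `tᵢ`. -/
def CorrEq {I : Type*} [Fintype I] {C : I → Type*} [∀ i, Fintype (C i)]
    (u : ∀ i : I, (∀ j, C j) → ℝ) : Set ((∀ j, C j) → ℝ) :=
  {π | π ∈ stdSimplex ℝ (∀ j, C j) ∧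
    ∀ (i : I) (si ti : C i),
      ∑ s : ∀ j, C j,
        (if s i = si then (u i (Function.update s i ti) - u i s) * π s else 0) ≤ 0}

/-- The product (independent) distributions on strategy profiles. -/
def prodDists {I : Type*} [Fintype I] (C : I → Type*) [∀ i, Fintype (C i)] :
    Set ((∀ j, C j) → ℝ) :=
  {π | ∃ ρ : ∀ i, C i → ℝ, (∀ i, ρ i ∈ stdSimplex ℝ (C i)) ∧
        π = fun s => ∏ i, ρ i (s i)}

/-- An action of a group `G` on a finite game with player set `I`, strategy sets `C i`
and utilities `u`.  `actI` is the left action on players and `actS` the induced left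
action on strategy profiles; `diagonal` expresses that the coordinate `g·i` of `g·s`
depends only on the coordinate `i` of `s` (i.e. the profile action is induced by strategy
maps `g· : C i → C (g·i)`), and `utility_inv` is the utility compatibility condition
`u_{g·i}(g·s) = u_i(s)`. -/
structure GameAction (G : Type*) [Group G] {I : Type*} (C : I → Type*)
    (u : ∀ i : I, (∀ j, C j) → ℝ) where
  actI : G → I → I
  actS : G → (∀ j, C j) → (∀ j, C j)
  actI_one : ∀ i, actI 1 i = i
  actI_mul : ∀ g h i, actI (g * h) i = actI g (actI h i)
  actS_one : ∀ s, actS 1 s = s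
  actS_mul : ∀ g h s, actS (g * h) s = actS g (actS h s)
  diagonal : ∀ g s t i, s i = t i → actS g s (actI g i) = actS g t (actI g i)
  utility_inv : ∀ g i s, u (actI g i) (actS g s) = u i s

/-- The action of `G × S_m` on the common profile set `C^m` of the powers `Γ^{Πm}` and
`Γ^{⊗m}`: `g` is applied in every copy (via the action of `G` on `Γ`) and `σ ∈ S_m`
permutes the copies. -/
def powAct {G : Type*} [Group G] {I : Type*} {C : I → Type*}
    {u : ∀ i : I, (∀ j, C j) → ℝ} (A : GameAction G C u) (m : ℕ)
    (g : G) (σ : Equiv.Perm (Fin m)) (s : ∀ i, Fin m → C i) : ∀ i, Fin m → C i :=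
  fun i j => A.actS g (fun k => s k (σ⁻¹ j)) i

/-- The `(G × S_m)`-invariant functions on profiles of the `m`-th powers. -/
def powInv {G : Type*} [Group G] {I : Type*} {C : I → Type*}
    {u : ∀ i : I, (∀ j, C j) → ℝ} (A : GameAction G C u) (m : ℕ) :
    Set ((∀ i, Fin m → C i) → ℝ) :=
  {π | ∀ (g : G) (σ : Equiv.Perm (Fin m)), (fun s => π (powAct A m g σ s)) = π}

/-- Utility of player `(i,j)` in the `m`-th power `Γ^{Πm}`. -/
noncomputable def uPow {I : Type*} {C : I → Type*}
    (u : ∀ i : I, (∀ j, C j) → ℝ) (m : ℕ) (i : I) (j : Fin m)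
    (s : ∀ k, Fin m → C k) : ℝ :=
  u i (fun k => s k j)

/-- Utility of player `i` in the contracted `m`-th power `Γ^{⊗m}`. -/
noncomputable def uTen {I : Type*} {C : I → Type*}
    (u : ∀ i : I, (∀ j, C j) → ℝ) (m : ℕ) (i : I) (s : ∀ k, Fin m → C k) : ℝ :=
  ∑ j : Fin m, u i (fun k => s k j)

/-- Product distributions of `Γ^{Πm}`: products over all `mn` players `(i,j)`. -/
def prodPow {I : Type*} [Fintype I] (C : I → Type*) [∀ i, Fintype (C i)] (m : ℕ) :
    Set ((∀ i, Fin m → C i) → ℝ) :=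
  {π | ∃ ρ : ∀ i, Fin m → C i → ℝ, (∀ i j, ρ i j ∈ stdSimplex ℝ (C i)) ∧
        π = fun s => ∏ i, ∏ j, ρ i j (s i j)}

/-- Product distributions of `Γ^{⊗m}`: products over the `n` players `i`. -/
def prodTen {I : Type*} [Fintype I] (C : I → Type*) [∀ i, Fintype (C i)] (m : ℕ) :
    Set ((∀ i, Fin m → C i) → ℝ) :=
  {π | ∃ ρ : ∀ i, (Fin m → C i) → ℝ, (∀ i, ρ i ∈ stdSimplex ℝ (Fin m → C i)) ∧
        π = fun s => ∏ i, ρ i (s i)}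

/-- `S` is dominated by no point: every `y` is weakly below all of `S` in some order `r i`. -/
def Dominant {I V L : Type*} [LinearOrder L] (r : I → V → L) (S : Finset V) : Prop :=
  ∀ y, ∃ i, ∀ s ∈ S, r i y ≤ r i s

/-- `y` exceeds the minimum of `τ` in every order except possibly the `k`-th, and is the largest
such point in the `k`-th order. -/
def IsTopFiller {I V L : Type*} [LinearOrder L] (r : I → V → L) (τ : Finset V) (k : I) (y : V) :
    Prop :=
  (∀ i, i ≠ k → ∃ s ∈ τ, r i s < r i y) ∧
    ∀ z, (∀ i, i ≠ k → ∃ s ∈ τ, r i s < r i z) → r k z ≤ r k y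

section Scarf

variable {I V L : Type*} [LinearOrder L]

theorem Dominant.mono {r : I → V → L} {S T : Finset V} (h : Dominant r S) (hT : T ⊆ S) :
    Dominant r T := fun y => (h y).imp fun _ hi s hs => hi s (hT hs)

theorem IsTopFiller.unique {r : I → V → L} (hr : ∀ i, Function.Injective (r i)) {τ : Finset V}
    {k : I} {y z : V} (hy : IsTopFiller r τ k y) (hz : IsTopFiller r τ k z) : y = z :=
  hr k (le_antisymm (hz.2 y hy.1) (hy.2 z hz.1))

theorem exists_isTopFiller [Fintype V] {r : I → V → L} {τ : Finset V} {k : I} {y : V}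
    (hy : ∀ i, i ≠ k → ∃ s ∈ τ, r i s < r i y) : ∃ z, IsTopFiller r τ k z := by
  obtain ⟨z, hz, hmax⟩ := Finset.exists_max_image
    (univ.filter fun y => ∀ i, i ≠ k → ∃ s ∈ τ, r i s < r i y) (r k) ⟨y, by simpa using hy⟩
  exact ⟨z, (mem_filter.1 hz).2, fun w hw => hmax w (by simpa using hw)⟩

/-- The points completing a dominant set of size `card I - 1` to one of size `card I`. -/
theorem exists_insert_dominant_iff [Fintype I] {r : I → V → L} (hr : ∀ i, Function.Injective (r i))
    {τ : Finset V} (hτ : Dominant r τ) (hne : τ.Nonempty) (hcard : τ.card + 1 = Fintype.card I) :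
    ∃ d₁ d₂ : I, d₁ ≠ d₂ ∧ ∀ y, (y ∉ τ ∧ Dominant r (insert y τ)) ↔
      IsTopFiller r τ d₁ y ∨ IsTopFiller r τ d₂ y := by
  have hmin : ∀ i, ∃ x ∈ τ, ∀ s ∈ τ, r i x ≤ r i s := fun i => τ.exists_min_image (r i) hne
  choose a haτ hamin using hmin
  obtain ⟨d₁, -, d₂, -, hd, had⟩ := Finset.exists_ne_map_eq_of_card_lt_of_maps_to
    (s := (univ : Finset I)) (t := τ) (f := a) (by rw [card_univ]; omega) (fun i _ => haτ i)
  have hsurj : ∀ x ∈ τ, ∃ i, a i = x := fun x hx => by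
    obtain ⟨i, hi⟩ := hτ x
    exact ⟨i, hr i (le_antisymm (hamin i x hx) (hi _ (haτ i)))⟩
  have hfill : ∀ k, (k = d₁ ∨ k = d₂) → ∀ y, IsTopFiller r τ k y →
      y ∉ τ ∧ Dominant r (insert y τ) := by
    intro k hk y hy
    constructor
    · intro hyτ
      have : ∃ i, i ≠ k ∧ a i = y := by
        obtain ⟨i, rfl⟩ := hsurj y hyτ
        by_cases hik : i = k
        · subst hik
          rcases hk with rfl | rfl
          · exact ⟨d₂, hd.symm, had.symm⟩
          · exact ⟨d₁, hd, had⟩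
        · exact ⟨i, hik, rfl⟩
      obtain ⟨i, hik, rfl⟩ := this
      obtain ⟨s, hs, hlt⟩ := hy.1 i hik
      exact absurd (hamin i s hs) (not_le.2 hlt)
    · intro z
      by_cases hz : ∀ i, i ≠ k → ∃ s ∈ τ, r i s < r i z
      · obtain ⟨i, hi⟩ := hτ z
        have hik : i = k := by
          by_contra hik
          obtain ⟨s, hs, hlt⟩ := hz i hik
          exact absurd (hi s hs) (not_le.2 hlt)
        subst hik
        exact ⟨i, fun s hs => (mem_insert.1 hs).elim (fun h => h ▸ hy.2 z hz) (hi s)⟩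
      · push Not at hz
        obtain ⟨i, hik, hi⟩ := hz
        obtain ⟨s, hs, hlt⟩ := hy.1 i hik
        exact ⟨i, fun t ht => (mem_insert.1 ht).elim
          (fun h => h ▸ (hi s hs).trans hlt.le) (hi t)⟩
  refine ⟨d₁, d₂, hd, fun y => ⟨?_, ?_⟩⟩
  · rintro ⟨hyτ, hy⟩
    obtain ⟨k, hk⟩ := hy y
    have hka : ∀ x ∈ τ, ∃ i, i ≠ k ∧ a i = x := fun x hx => by
      obtain ⟨i, hi⟩ := hy x
      refine ⟨i, ?_, hr i (le_antisymm (hamin i x hx) (hi _ (mem_insert_of_mem (haτ i))))⟩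
      rintro rfl
      exact hyτ (hr i (le_antisymm (hk x (mem_insert_of_mem hx))
        (hi y (mem_insert_self _ _))) ▸ hx)
    have hinj : Set.InjOn a (univ.erase k : Finset I) := by
      apply Finset.injOn_of_card_image_eq
      have : (univ.erase k).image a = τ := by
        ext x
        simp only [mem_image, mem_erase, mem_univ, and_true]
        exact ⟨fun ⟨i, _, h⟩ => h ▸ haτ i, fun hx => hka x hx⟩
      rw [this, card_erase_of_mem (mem_univ _), card_univ]
      omega
    have hkd : k = d₁ ∨ k = d₂ := by
      by_contra! h
      exact hd (hinj (by simpa using h.1.symm) (by simpa using h.2.symm) had)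
    have hlt : ∀ i, i ≠ k → r i (a i) < r i y := by
      intro i hik
      obtain ⟨j, hj⟩ := hy (a i)
      have hjk : j ≠ k := by
        rintro rfl
        exact hyτ (hr j (le_antisymm (hk (a i) (mem_insert_of_mem (haτ i)))
          (hj y (mem_insert_self _ _))) ▸ haτ i)
      have haj : a j = a i :=
        hr j (le_antisymm (hamin j _ (haτ i)) (hj _ (mem_insert_of_mem (haτ j))))
      have hji : j = i := hinj (by simpa using hjk) (by simpa using hik) haj
      subst hji
      exact lt_of_le_of_ne (hj y (mem_insert_self _ _)) fun h => hyτ (hr j h ▸ haτ j)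
    have htop : IsTopFiller r τ k y := by
      refine ⟨fun i hik => ⟨a i, haτ i, hlt i hik⟩, fun z hz => ?_⟩
      obtain ⟨i, hi⟩ := hy z
      have hik : i = k := by
        by_contra hik
        obtain ⟨s, hs, hlt⟩ := hz i hik
        exact absurd (hi s (mem_insert_of_mem hs)) (not_le.2 hlt)
      exact hik ▸ hi y (mem_insert_self _ _)
    rcases hkd with rfl | rfl
    exacts [Or.inl htop, Or.inr htop]
  · rintro (h | h)
    exacts [hfill _ (Or.inl rfl) y h, hfill _ (Or.inr rfl) y h]

theorem even_card_insert_dominant [Fintype I] [Fintype V] {r : I → V → L}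
    (hr : ∀ i, Function.Injective (r i))
    {e : I → V} (he : ∀ i j, i ≠ j → ∀ v, v ∉ Set.range e → r i v < r i (e j))
    {τ : Finset V} (hcard : τ.card + 1 = Fintype.card I) (hv : ∃ v ∈ τ, v ∉ Set.range e) :
    Even (univ.filter fun y => y ∉ τ ∧ Dominant r (insert y τ)).card := by
  by_cases hτ : Dominant r τ
  · obtain ⟨v, hvτ, hv⟩ := hv
    obtain ⟨d₁, d₂, hd, h⟩ := exists_insert_dominant_iff hr hτ ⟨v, hvτ⟩ hcard
    have hex : ∀ k, ∃ y, IsTopFiller r τ k y := fun k =>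
      exists_isTopFiller (y := e k) fun i hik => ⟨v, hvτ, he i k hik v hv⟩
    obtain ⟨y₁, h₁⟩ := hex d₁
    obtain ⟨y₂, h₂⟩ := hex d₂
    have hne : y₁ ≠ y₂ := by
      rintro rfl
      obtain ⟨i, hi⟩ := hτ y₁
      have : ∃ s ∈ τ, r i s < r i y₁ := by
        by_cases hi₁ : i = d₁
        · exact h₂.1 i (hi₁ ▸ hd)
        · exact h₁.1 i hi₁
      obtain ⟨s, hs, hlt⟩ := this
      exact absurd (hi s hs) (not_le.2 hlt)
    have : (univ.filter fun y => y ∉ τ ∧ Dominant r (insert y τ)) = {y₁, y₂} := by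
      ext y
      simp only [mem_filter, mem_univ, true_and, h, mem_insert, mem_singleton]
      constructor
      · rintro (hy | hy)
        exacts [Or.inl (hy.unique hr h₁), Or.inr (hy.unique hr h₂)]
      · rintro (rfl | rfl)
        exacts [Or.inl h₁, Or.inr h₂]
    rw [this, card_pair hne]
    exact even_two
  · rw [filter_false_of_mem fun y _ h => hτ (h.2.mono (subset_insert _ _))]
    simp

theorem card_insert_dominant_boundary [Fintype I] [Fintype V] {r : I → V → L}
    (hr : ∀ i, Function.Injective (r i))
    {e : I → V} (hmin : ∀ i v, r i (e i) ≤ r i v)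
    (he : ∀ i j, i ≠ j → ∀ v, v ∉ Set.range e → r i v < r i (e j)) (hinj : Function.Injective e)
    (i₀ : I) :
    (univ.filter fun y => y ∉ (univ.erase i₀).image e ∧
      Dominant r (insert y ((univ.erase i₀).image e))).card = 1 := by
  set τ := (univ.erase i₀).image e with hτ
  have hmem : ∀ i, e i ∈ τ ↔ i ≠ i₀ := fun i => by
    simp [hτ, hinj.eq_iff]
  have hrange : ∀ z, z ∉ τ → z = e i₀ ∨ z ∉ Set.range e := by
    intro z hz
    by_cases h : z ∈ Set.range e
    · obtain ⟨j, rfl⟩ := h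
      rw [hmem, not_not] at hz
      exact Or.inl (hz ▸ rfl)
    · exact Or.inr h
  have key : ∀ y, (y ∉ τ ∧ Dominant r (insert y τ)) ↔ y ∉ τ ∧ ∀ z, z ∉ τ → r i₀ z ≤ r i₀ y := by
    refine fun y => and_congr_right fun hy => ⟨fun h z hz => ?_, fun h z => ?_⟩
    · obtain ⟨i, hi⟩ := h z
      have : i = i₀ := by
        by_contra hii
        have hei := (hmem i).2 hii
        exact hz (hr i (le_antisymm (hi _ (mem_insert_of_mem hei)) (hmin i z)) ▸ hei)
      exact this ▸ hi y (mem_insert_self _ _)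
    · by_cases hz : z ∈ τ
      · obtain ⟨j, -, rfl⟩ := mem_image.1 hz
        exact ⟨j, fun s _ => hmin j s⟩
      · refine ⟨i₀, fun s hs => (mem_insert.1 hs).elim (fun hsy => hsy ▸ h z hz) fun hs => ?_⟩
        rcases hrange z hz with rfl | hzr
        · exact hmin _ _
        · obtain ⟨j, hj, rfl⟩ := mem_image.1 hs
          exact (he i₀ j (ne_of_mem_erase hj).symm z hzr).le
  obtain ⟨y, hy, hmax⟩ := Finset.exists_max_image (univ.filter fun y => y ∉ τ) (r i₀)
    ⟨e i₀, by simp [hmem]⟩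
  have hyτ := (mem_filter.1 hy).2
  have hmax' : ∀ z, z ∉ τ → r i₀ z ≤ r i₀ y := fun z hz => hmax z (by simpa using hz)
  rw [card_eq_one]
  refine ⟨y, ?_⟩
  ext z
  simp only [mem_filter, mem_univ, true_and, key, mem_singleton]
  constructor
  · rintro ⟨hz, h⟩
    exact hr i₀ (le_antisymm (hmax' z hz) (h y hyτ))
  · rintro rfl
    exact ⟨hyτ, hmax'⟩

theorem even_card_erase_image [Fintype I] {c : V → I} {S : Finset V}
    (hcard : S.card = Fintype.card I)
    (hS : S.image c ≠ univ) (i₀ : I) :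
    Even (S.filter fun x => (S.erase x).image c = univ.erase i₀).card := by
  rcases (S.filter fun x => (S.erase x).image c = univ.erase i₀).eq_empty_or_nonempty with
    h | ⟨x, hx⟩
  · simp [h]
  obtain ⟨hxS, hxc⟩ := mem_filter.1 hx
  have hinj : Set.InjOn c (S.erase x : Finset V) := by
    apply Finset.injOn_of_card_image_eq
    rw [hxc, card_erase_of_mem (mem_univ _), card_erase_of_mem hxS, card_univ, hcard]
  have hcx : c x ≠ i₀ := by
    rintro rfl
    apply hS
    rw [← insert_erase hxS, image_insert, hxc, insert_erase (mem_univ _)]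
  have hx' : c x ∈ (S.erase x).image c := by rw [hxc]; simpa using hcx
  obtain ⟨x', hx'S, hxx'⟩ := mem_image.1 hx'
  replace hx'S := mem_erase.1 hx'S
  obtain ⟨hne, hx'S⟩ := hx'S
  have hmove : (S.erase x').image c = (S.erase x).image c := by
    ext i
    simp only [mem_image, mem_erase]
    constructor
    · rintro ⟨z, ⟨hz, hzS⟩, rfl⟩
      by_cases hzx : z = x
      · exact ⟨x', ⟨hne, hx'S⟩, hzx ▸ hxx'⟩
      · exact ⟨z, ⟨hzx, hzS⟩, rfl⟩
    · rintro ⟨z, ⟨hz, hzS⟩, rfl⟩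
      by_cases hzx : z = x'
      · exact ⟨x, ⟨hne.symm, hxS⟩, hzx ▸ hxx'.symm⟩
      · exact ⟨z, ⟨hzx, hzS⟩, rfl⟩
  have : (S.filter fun x => (S.erase x).image c = univ.erase i₀) = {x, x'} := by
    ext w
    simp only [mem_filter, mem_insert, mem_singleton]
    constructor
    · rintro ⟨hwS, hw⟩
      by_contra! hwx
      have hwc : c w ∈ (S.erase w).image c := by
        rw [hw, ← hxc]
        exact mem_image_of_mem c (mem_erase.2 ⟨hwx.1, hwS⟩)
      obtain ⟨z, hz, hzw⟩ := mem_image.1 hwc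
      obtain ⟨hzne, hzS⟩ := mem_erase.1 hz
      by_cases hzx : z = x
      · exact hwx.2 (hinj (mem_coe.2 (mem_erase.2 ⟨hwx.1, hwS⟩))
          (mem_coe.2 (mem_erase.2 ⟨hne, hx'S⟩)) (hzw.symm.trans (hzx ▸ hxx'.symm)))
      · exact hzne (hinj (mem_coe.2 (mem_erase.2 ⟨hzx, hzS⟩))
          (mem_coe.2 (mem_erase.2 ⟨hwx.1, hwS⟩)) hzw)
    · rintro (rfl | rfl)
      exacts [⟨hxS, hxc⟩, ⟨hx'S, hmove.trans hxc⟩]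
  rw [this, card_pair hne.symm]
  exact even_two

/-- Scarf's combinatorial lemma: some dominant set carries every colour exactly once. -/
theorem exists_dominant_image_eq_univ [Fintype I] [Fintype V] [Nonempty I] {r : I → V → L}
    (hr : ∀ i, Function.Injective (r i)) {e : I → V} (hmin : ∀ i v, r i (e i) ≤ r i v)
    (he : ∀ i j, i ≠ j → ∀ v, v ∉ Set.range e → r i v < r i (e j)) {c : V → I}
    (hc : ∀ i, c (e i) = i) :
    ∃ S : Finset V, Dominant r S ∧ S.card = Fintype.card I ∧ S.image c = univ := by
  by_contra! hno
  obtain ⟨i₀⟩ := ‹Nonempty I›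
  have hinj : Function.Injective e := Function.LeftInverse.injective hc
  let P : Finset V → V → Prop := fun τ y => (τ.card + 1 = Fintype.card I ∧
    τ.image c = univ.erase i₀) ∧ y ∉ τ ∧ Dominant r (insert y τ)
  let Q : Finset V → V → Prop := fun S x => (Dominant r S ∧ S.card = Fintype.card I) ∧
    x ∈ S ∧ (S.erase x).image c = univ.erase i₀
  have hPQ : (univ.filter fun p : Finset V × V => P p.1 p.2).card =
      (univ.filter fun p : Finset V × V => Q p.1 p.2).card := by
    refine Finset.card_nbij' (fun p => (insert p.2 p.1, p.2)) (fun p => (p.1.erase p.2, p.2))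
      ?_ ?_ ?_ ?_
    · rintro ⟨τ, y⟩ h
      obtain ⟨⟨h₁, h₂⟩, h₃, h₄⟩ := (mem_filter.1 h).2
      simp only at h₁ h₂ h₃ h₄
      simp [Q, h₁, h₂, h₃, h₄]
    · rintro ⟨S, y⟩ h
      obtain ⟨⟨h₁, h₂⟩, h₃, h₄⟩ := (mem_filter.1 h).2
      simp only at h₁ h₂ h₃ h₄
      have := (card_erase_add_one h₃).trans h₂
      refine mem_filter.2 ⟨mem_univ _, ⟨this, h₄⟩, notMem_erase _ _, ?_⟩
      simpa only [insert_erase h₃] using h₁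
    · rintro ⟨τ, y⟩ h
      have h₁ := (mem_filter.1 h).2.2.1
      simp only at h₁
      simp [h₁]
    · rintro ⟨S, y⟩ h
      have h₁ := (mem_filter.1 h).2.2.1
      simp only at h₁
      simp [h₁]
  simp only [card_filter, Fintype.sum_prod_type] at hPQ
  have hQ : Even (∑ S, (univ.filter fun x => Q S x).card) := by
    refine Finset.even_sum _ fun S _ => ?_
    by_cases hS : Dominant r S ∧ S.card = Fintype.card I
    · have hfilter : (univ.filter fun x => Q S x) =
          S.filter fun x => (S.erase x).image c = univ.erase i₀ := by
        ext x
        simp [Q, hS]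
      rw [hfilter]
      exact even_card_erase_image hS.2 (hno S hS.1 hS.2) i₀
    · simp [Q, hS]
  have hP : Odd (∑ τ, (univ.filter fun y => P τ y).card) := by
    set τ₀ := (univ.erase i₀).image e with hτ₀
    rw [← Finset.add_sum_erase _ _ (mem_univ τ₀)]
    have hcard₀ : τ₀.card + 1 = Fintype.card I := by
      rw [hτ₀, card_image_of_injective _ hinj, card_erase_add_one (mem_univ _), card_univ]
    have hcol₀ : τ₀.image c = univ.erase i₀ := by
      rw [hτ₀, image_image, show c ∘ e = id from funext hc, image_id]
    have hone : (univ.filter fun y => P τ₀ y).card = 1 := by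
      refine Eq.trans (congrArg card ?_) (card_insert_dominant_boundary hr hmin he hinj i₀)
      ext y
      simp only [P, mem_filter, mem_univ, true_and, hcard₀, hcol₀, ← hτ₀]
    rw [hone]
    refine Odd.add_even odd_one (Finset.even_sum _ fun τ hτ => ?_)
    by_cases h : τ.card + 1 = Fintype.card I ∧ τ.image c = univ.erase i₀
    · simp only [P, h, true_and, and_self]
      refine even_card_insert_dominant hr he h.1 ?_
      by_contra! hall
      refine (mem_erase.1 hτ).1 (Finset.eq_of_subset_of_card_le ?_ ?_)
      · intro v hv
        obtain ⟨i, rfl⟩ := hall v hv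
        have : c (e i) ∈ univ.erase i₀ := h.2 ▸ mem_image_of_mem c hv
        rw [hc] at this
        exact mem_image_of_mem e this
      · omega
    · simp [P, h]
  simp only [card_filter] at hP hQ
  rw [hPQ] at hP
  exact (Nat.not_even_iff_odd.2 hP) hQ

end Scarf

section Equilibrium

variable {I : Type*} [Fintype I] [Nonempty I]

/-- A set of grid points of `N · Δ` that is dominated by no grid point has diameter at most
`card I` in every coordinate. -/
theorem exists_grid_colouring (N : ℕ) (c : (I → ℕ) → I) :
    ∃ t : I → ℕ, ∑ i, t i = N ∧ ∀ j, t j ≤ Fintype.card I ∨ ∃ s : I → ℕ, ∑ i, s i = N ∧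
      (∀ i, s i ≤ t i + Fintype.card I ∧ t i ≤ s i + Fintype.card I) ∧ c s = j := by
  let T := {k : I → ℕ // k ∈ Finset.piAntidiag univ N}
  have : Fintype T := inferInstanceAs (Fintype (Finset.piAntidiag (univ : Finset I) N))
  have hT : ∀ k : I → ℕ, ∑ i, k i = N → k ∈ Finset.piAntidiag univ N := fun k hk => by
    simp [mem_piAntidiag, hk]
  have hTsum : ∀ t : T, ∑ i, t.1 i = N := fun t => (mem_piAntidiag.1 t.2).1
  let enc := Fintype.equivFin (T ⊕ I)
  let val : I → T ⊕ I → ℤ := fun i v =>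
    Sum.elim (fun t => (t.1 i : ℤ)) (fun j => if i = j then -1 else N + 1) v
  let r : I → T ⊕ I → ℤ ×ₗ ℕ := fun i v => toLex (val i v, (enc v : ℕ))
  have hlt : ∀ i v w, val i v < val i w → r i v < r i w := fun i v w h =>
    Prod.Lex.toLex_lt_toLex.2 (Or.inl h)
  have hval : ∀ i v w, r i v ≤ r i w → val i v ≤ val i w := fun i v w h => by
    by_contra! h'
    exact absurd h (not_le.2 (hlt _ _ _ h'))
  have hr : ∀ i, Function.Injective (r i) := by
    intro i v w h
    have h2 : (enc v : ℕ) = enc w := congrArg (fun p => (ofLex p).2) h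
    exact enc.injective (Fin.ext h2)
  have hle : ∀ (t : T) i, t.1 i ≤ N := fun t i =>
    (Finset.single_le_sum (f := t.1) (fun _ _ => Nat.zero_le _) (mem_univ i)).trans (hTsum t).le
  have hmin : ∀ i v, r i (Sum.inr i) ≤ r i v := by
    intro i v
    by_cases hv : v = Sum.inr i
    · rw [hv]
    · refine (hlt _ _ _ ?_).le
      rcases v with t | j
      · simp only [val, Sum.elim_inr, Sum.elim_inl, if_true]
        omega
      · have : i ≠ j := fun h => hv (h ▸ rfl)
        simp only [val, Sum.elim_inr, if_true, if_neg this]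
        omega
  have he : ∀ i j, i ≠ j → ∀ v, v ∉ Set.range (Sum.inr : I → T ⊕ I) →
      r i v < r i (Sum.inr j) := by
    rintro i j hij (t | k) hv
    · refine hlt _ _ _ ?_
      have := hle t i
      simp only [val, Sum.elim_inr, Sum.elim_inl, if_neg hij]
      omega
    · exact absurd ⟨k, rfl⟩ hv
  obtain ⟨S, hS, -, hcol⟩ := exists_dominant_image_eq_univ hr hmin he
    (c := Sum.elim (fun t : T => c t.1) id) (fun i => rfl)
  have hcolour : ∀ j, Sum.inr j ∉ S → ∃ t : T, Sum.inl t ∈ S ∧ c t.1 = j := by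
    intro j hj
    obtain ⟨v, hv, hvj⟩ := mem_image.1 (hcol ▸ mem_univ j)
    rcases v with t | k
    · exact ⟨t, hv, hvj⟩
    · exact absurd (by simpa using hvj ▸ hv) hj
  have hJ : ∃ j, Sum.inr j ∉ S := by
    let i₀ := Classical.arbitrary I
    obtain ⟨j, hj⟩ := hS (Sum.inl ⟨Pi.single i₀ N, hT _ (by simp)⟩)
    refine ⟨j, fun hjS => ?_⟩
    have := hval _ _ _ (hj _ hjS)
    simp only [val, Sum.elim_inr, Sum.elim_inl, if_true] at this
    omega
  obtain ⟨j₀, hj₀⟩ := hJ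
  obtain ⟨t₀, ht₀, -⟩ := hcolour j₀ hj₀
  have hm : ∀ i, ∃ m : ℕ, (∀ t : T, Sum.inl t ∈ S → m ≤ t.1 i) ∧ (Sum.inr i ∈ S → m = 0) ∧
      (Sum.inr i ∉ S → ∀ y : T, m < y.1 i → ∃ s ∈ S, r i s < r i (Sum.inl y)) := by
    intro i
    by_cases hi : Sum.inr i ∈ S
    · exact ⟨0, fun _ _ => Nat.zero_le _, fun _ => rfl, fun h => absurd hi h⟩
    · obtain ⟨s, hs, hsmin⟩ := S.exists_min_image (r i) ⟨_, ht₀⟩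
      rcases s with t | j
      · refine ⟨t.1 i, fun t' ht' => ?_, fun h => absurd h hi, fun _ y hy => ⟨_, hs, ?_⟩⟩
        · have := hval _ _ _ (hsmin _ ht')
          simpa [val] using this
        · exact hlt _ _ _ (by simpa [val] using hy)
      · have hij : i ≠ j := fun h => hi (h ▸ hs)
        exact absurd (hsmin _ ht₀) (not_le.2 (he i j hij _ (by simp)))
  choose m hm₁ hm₂ hm₃ using hm
  have hsum : N < ∑ i, m i + Fintype.card I := by
    by_contra! hN
    let y₀ : I → ℕ := fun i => m i + 1
    let y : I → ℕ := y₀ + Pi.single j₀ (N - ∑ i, y₀ i)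
    have hy₀ : ∑ i, y₀ i ≤ N := by
      simp only [y₀, sum_add_distrib, sum_const, card_univ, smul_eq_mul, mul_one]
      exact hN
    have hy : ∑ i, y i = N := by
      simp only [y, Pi.add_apply, sum_add_distrib, sum_pi_single', mem_univ, if_true]
      omega
    obtain ⟨i, hi⟩ := hS (Sum.inl ⟨y, hT y hy⟩)
    by_cases hiS : Sum.inr i ∈ S
    · have := hval _ _ _ (hi _ hiS)
      simp only [val, Sum.elim_inr, Sum.elim_inl, if_true] at this
      omega
    · obtain ⟨s, hs, hlt'⟩ := hm₃ i hiS ⟨y, hT y hy⟩ (by simp [y, y₀]; omega)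
      exact absurd (hi s hs) (not_le.2 hlt')
  have hbound : ∀ t : T, Sum.inl t ∈ S → ∀ i, t.1 i ≤ m i + Fintype.card I := by
    intro t ht i
    have h₁ : ∑ i, (t.1 i - m i) + ∑ i, m i = N := by
      rw [← sum_add_distrib]
      exact (sum_congr rfl fun i _ => Nat.sub_add_cancel (hm₁ i t ht)).trans (hTsum t)
    have h₂ : t.1 i - m i ≤ ∑ i, (t.1 i - m i) :=
      Finset.single_le_sum (f := fun i => t.1 i - m i) (fun _ _ => Nat.zero_le _) (mem_univ i)
    omega
  refine ⟨t₀.1, hTsum t₀, fun j => ?_⟩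
  by_cases hj : Sum.inr j ∈ S
  · left
    have := hbound t₀ ht₀ j
    rw [hm₂ j hj] at this
    omega
  · right
    obtain ⟨s, hs, hsj⟩ := hcolour j hj
    refine ⟨s.1, hTsum s, fun i => ?_, hsj⟩
    have h₁ := hbound t₀ ht₀ i
    have h₂ := hbound s hs i
    have h₃ := hm₁ i t₀ ht₀
    have h₄ := hm₁ i s hs
    omega

/-- A continuous vector field `f` on the simplex admits a point where every coordinate in the
support attains the maximum of `f`. -/
theorem exists_mem_stdSimplex_forall_pos_max {f : (I → ℝ) → I → ℝ}
    (hf : ContinuousOn f (stdSimplex ℝ I)) :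
    ∃ x ∈ stdSimplex ℝ I, ∀ j, x j = 0 ∨ ∀ k, f x k ≤ f x j := by
  have hmax : ∀ x, ∃ j, ∀ k, f x k ≤ f x j := fun x => Finite.exists_max (f x)
  choose c hc using hmax
  let q : ℕ → (I → ℕ) → I → ℝ := fun N t i => (t i : ℝ) / (N + 1)
  have hq : ∀ N t, ∑ i, t i = N + 1 → q N t ∈ stdSimplex ℝ I := by
    intro N t ht
    refine ⟨fun i => by positivity, ?_⟩
    have : (∑ i, (t i : ℝ)) = N + 1 := by exact_mod_cast ht
    simp only [q, ← Finset.sum_div, this]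
    field_simp
  let ε : ℕ → ℝ := fun N => Fintype.card I / (N + 1 : ℝ)
  have hε : Filter.Tendsto ε Filter.atTop (nhds 0) := by
    simpa [ε, div_eq_mul_inv] using
      (tendsto_one_div_add_atTop_nhds_zero_nat (𝕜 := ℝ)).const_mul (Fintype.card I : ℝ)
  have happrox : ∀ N : ℕ, ∃ x ∈ stdSimplex ℝ I, ∀ j, ∃ s ∈ stdSimplex ℝ I,
      (∀ i, |s i - x i| ≤ ε N) ∧ (x j ≤ ε N ∨ ∀ k, f s k ≤ f s j) := by
    intro N
    obtain ⟨t, ht, h⟩ := exists_grid_colouring (N + 1) (fun t => c (q N t))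
    refine ⟨q N t, hq N t ht, fun j => ?_⟩
    rcases h j with hj | ⟨s, hs, hst, rfl⟩
    · refine ⟨q N t, hq N t ht, fun i => by simp only [sub_self, abs_zero, ε]; positivity,
        Or.inl ?_⟩
      simp only [q, ε]
      gcongr
    · refine ⟨q N s, hq N s hs, fun i => ?_, Or.inr (hc _)⟩
      have h₁ : (s i : ℝ) ≤ t i + Fintype.card I := by exact_mod_cast (hst i).1
      have h₂ : (t i : ℝ) ≤ s i + Fintype.card I := by exact_mod_cast (hst i).2
      simp only [q, ε]
      rw [← sub_div, abs_div, abs_of_pos (by positivity : (0 : ℝ) < N + 1)]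
      gcongr
      rw [abs_le]
      constructor <;> linarith
  choose x hx s hs hsx hxs using happrox
  obtain ⟨a, ha, φ, hφ, hlim⟩ := (isCompact_stdSimplex ℝ I).tendsto_subseq hx
  have hεφ := hε.comp hφ.tendsto_atTop
  refine ⟨a, ha, fun j => or_iff_not_imp_left.2 fun hj k => ?_⟩
  have haj : 0 < a j := lt_of_le_of_ne (ha.1 j) (Ne.symm hj)
  have hslim : Filter.Tendsto (fun N => s (φ N) j) Filter.atTop (nhds a) := by
    rw [tendsto_pi_nhds] at hlim ⊢
    intro i
    have hdiff : Filter.Tendsto (fun N => s (φ N) j i - x (φ N) i) Filter.atTop (nhds 0) :=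
      squeeze_zero_norm (fun N => hsx (φ N) j i) hεφ
    simpa using hdiff.add (hlim i)
  have hflim : ∀ l, Filter.Tendsto (fun N => f (s (φ N) j) l) Filter.atTop (nhds (f a l)) := by
    have := (hf a ha).tendsto.comp (tendsto_nhdsWithin_iff.2
      ⟨hslim, Filter.Eventually.of_forall fun N => hs (φ N) j⟩)
    exact fun l => (tendsto_pi_nhds.1 this) l
  refine le_of_tendsto_of_tendsto (hflim k) (hflim j) ?_
  have hev := hεφ.eventually_lt ((tendsto_pi_nhds.1 hlim) j) haj
  filter_upwards [hev] with N hN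
  exact (hxs (φ N) j).resolve_left (not_le.2 hN) k

theorem exists_mem_stdSimplex_forall_nonpos {f : (I → ℝ) → I → ℝ}
    (hf : ContinuousOn f (stdSimplex ℝ I)) (hzero : ∀ x ∈ stdSimplex ℝ I, ∑ i, x i * f x i = 0) :
    ∃ x ∈ stdSimplex ℝ I, ∀ i, f x i ≤ 0 := by
  obtain ⟨x, hx, h⟩ := exists_mem_stdSimplex_forall_pos_max hf
  obtain ⟨k, hk⟩ := Finite.exists_max (f x)
  refine ⟨x, hx, fun i => (hk i).trans (le_of_eq ?_)⟩
  have hterm : ∀ j, x j * f x j = x j * f x k := fun j => by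
    rcases h j with hj | hj
    · simp [hj]
    · rw [le_antisymm (hk j) (hj k)]
  have := hzero x hx
  simp only [hterm, ← Finset.sum_mul, hx.2, one_mul] at this
  exact this

end Equilibrium

/-- Existence of solutions of variational inequalities on compact convex sets. -/
theorem exists_variational_inequality {E : Type*} [AddCommGroup E] [Module ℝ E]
    [TopologicalSpace E] [ContinuousAdd E] [ContinuousSMul ℝ E] {K : Set E} (hK : IsCompact K)
    (hconv : Convex ℝ K) (hne : K.Nonempty) (B : E → E →ₗ[ℝ] ℝ)
    (hB : ∀ σ, Continuous fun ρ => B ρ σ) (hBd : Continuous fun ρ => B ρ ρ) :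
    ∃ ρ ∈ K, ∀ σ ∈ K, B ρ σ ≤ B ρ ρ := by
  have key := hK.inter_iInter_nonempty (fun σ : K => {ρ | B ρ σ ≤ B ρ ρ})
    (fun σ => isClosed_le (hB σ) hBd) ?_
  · obtain ⟨ρ, hρ, h⟩ := key
    exact ⟨ρ, hρ, fun σ hσ => Set.mem_iInter.1 h ⟨σ, hσ⟩⟩
  intro t
  rcases t.eq_empty_or_nonempty with rfl | ht
  · simpa using hne
  have : Nonempty t := ht.to_subtype
  let p : (t → ℝ) → E := fun x => ∑ i, x i • (i : E)
  have hp : Continuous p := by fun_prop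
  obtain ⟨x, hx, h⟩ := exists_mem_stdSimplex_forall_nonpos (I := t)
    (f := fun x i => B (p x) i - B (p x) (p x))
    (continuous_pi fun i => ((hB _).comp hp).sub (hBd.comp hp)).continuousOn (by
      intro x hx
      have : B (p x) (p x) = ∑ i, x i * B (p x) i := by
        conv_lhs => rw [show p x = ∑ i, x i • (i : E) from rfl, map_sum]
        simp [p]
      simp only [mul_sub, Finset.sum_sub_distrib, ← Finset.sum_mul, hx.2, one_mul, ← this,
        sub_self])
  refine ⟨p x, hconv.sum_mem (fun i _ => hx.1 i) hx.2 fun i _ => i.1.2, ?_⟩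
  simp only [Set.mem_iInter]
  intro σ hσ
  exact sub_nonpos.1 (h ⟨σ, hσ⟩)

/-- The map induced on the disjoint union of the strategy sets by an action on a game. -/
noncomputable def GameAction.act {G : Type*} [Group G] {I : Type*} {C : I → Type*}
    [∀ i, Nonempty (C i)] {u : ∀ i : I, (∀ j, C j) → ℝ} (A : GameAction G C u) (g : G)
    (x : Σ i, C i) : Σ i, C i :=
  ⟨A.actI g x.1, A.actS g (Function.update (fun _ => Classical.arbitrary _) x.1 x.2) (A.actI g x.1)⟩

/-- The weights, normalised per player, describing profiles of mixed strategies. -/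
def mixedProfiles {I : Type*} (C : I → Type*) [∀ i, Fintype (C i)] : Set ((Σ i, C i) → ℝ) :=
  {ρ | (∀ x, 0 ≤ ρ x) ∧ ∀ i, ∑ a, ρ ⟨i, a⟩ = 1}

/-- The payoff of the pure strategy `x` against the mixed strategies of the other players. -/
noncomputable def payoffAgainst {I : Type*} [Fintype I] {C : I → Type*} [∀ i, Fintype (C i)]
    (u : ∀ i : I, (∀ j, C j) → ℝ) (ρ : (Σ i, C i) → ℝ) (x : Σ i, C i) : ℝ :=
  ∑ s : ∀ j, C j, if (⟨x.1, s x.1⟩ : Σ i, C i) = x then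
    (∏ k ∈ univ.erase x.1, ρ ⟨k, s k⟩) * u x.1 s else 0

section Action

variable {G : Type*} [Group G] {I : Type*} {C : I → Type*} {u : ∀ i : I, (∀ j, C j) → ℝ}

theorem GameAction.actI_bijective (A : GameAction G C u) (g : G) :
    Function.Bijective (A.actI g) :=
  Function.bijective_iff_has_inverse.2 ⟨A.actI g⁻¹,
    fun i => by rw [← A.actI_mul, inv_mul_cancel, A.actI_one],
    fun i => by rw [← A.actI_mul, mul_inv_cancel, A.actI_one]⟩

theorem GameAction.actS_bijective (A : GameAction G C u) (g : G) :
    Function.Bijective (A.actS g) :=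
  Function.bijective_iff_has_inverse.2 ⟨A.actS g⁻¹,
    fun i => by rw [← A.actS_mul, inv_mul_cancel, A.actS_one],
    fun i => by rw [← A.actS_mul, mul_inv_cancel, A.actS_one]⟩

variable [∀ i, Nonempty (C i)]

theorem GameAction.act_mk (A : GameAction G C u) (g : G) (s : ∀ j, C j) (i : I) :
    A.act g ⟨i, s i⟩ = ⟨A.actI g i, A.actS g s (A.actI g i)⟩ := by
  rw [GameAction.act, A.diagonal g _ s i (by simp)]

omit [∀ i, Nonempty (C i)] in
theorem sigma_mk_apply_congr (s : ∀ j, C j) {i j : I} (h : i = j) :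
    (⟨i, s i⟩ : Σ i, C i) = ⟨j, s j⟩ := by rw [h]

theorem exists_profile_mk_eq (x : Σ i, C i) : ∃ s : ∀ j, C j, x = ⟨x.1, s x.1⟩ :=
  ⟨Function.update (fun _ => Classical.arbitrary _) x.1 x.2, by simp⟩

theorem GameAction.act_one (A : GameAction G C u) (x : Σ i, C i) : A.act 1 x = x := by
  obtain ⟨s, hs⟩ := exists_profile_mk_eq x
  rw [hs, A.act_mk, A.actS_one]
  exact sigma_mk_apply_congr s (A.actI_one _)

theorem GameAction.act_mul (A : GameAction G C u) (g h : G) (x : Σ i, C i) :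
    A.act (g * h) x = A.act g (A.act h x) := by
  obtain ⟨s, hs⟩ := exists_profile_mk_eq x
  rw [hs, A.act_mk, A.act_mk, A.act_mk, A.actS_mul]
  exact sigma_mk_apply_congr _ (A.actI_mul _ _ _)

theorem GameAction.act_bijective (A : GameAction G C u) (g : G) : Function.Bijective (A.act g) :=
  Function.bijective_iff_has_inverse.2 ⟨A.act g⁻¹,
    fun i => by rw [← A.act_mul, inv_mul_cancel, A.act_one],
    fun i => by rw [← A.act_mul, mul_inv_cancel, A.act_one]⟩

variable [Fintype I] [∀ i, Fintype (C i)]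

theorem payoffAgainst_act (A : GameAction G C u) {ρ : (Σ i, C i) → ℝ}
    (hρ : ∀ g x, ρ (A.act g x) = ρ x) (g : G) (x : Σ i, C i) :
    payoffAgainst u ρ (A.act g x) = payoffAgainst u ρ x := by
  unfold payoffAgainst
  refine (Function.Bijective.sum_comp (A.actS_bijective g) _).symm.trans
    (sum_congr rfl fun s _ => ?_)
  have hcond : (⟨(A.act g x).1, A.actS g s (A.act g x).1⟩ : Σ i, C i) = A.act g x ↔
      (⟨x.1, s x.1⟩ : Σ i, C i) = x := by
    rw [← (A.act_bijective g).1.eq_iff (a := ⟨x.1, s x.1⟩), A.act_mk]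
    rfl
  simp only [hcond]
  split_ifs
  · congr 1
    · symm
      refine Finset.prod_bij (fun k _ => A.actI g k) ?_ ?_ ?_ ?_
      · intro k hk
        exact mem_erase.2 ⟨fun h => ne_of_mem_erase hk ((A.actI_bijective g).1 h), mem_univ _⟩
      · intro k _ l _ h
        exact (A.actI_bijective g).1 h
      · intro l hl
        obtain ⟨k, rfl⟩ := (A.actI_bijective g).2 l
        exact ⟨k, mem_erase.2 ⟨fun h => ne_of_mem_erase hl (h ▸ rfl), mem_univ _⟩, rfl⟩
      · intro k _
        rw [← hρ g, A.act_mk]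
    · exact A.utility_inv g x.1 s
  · rfl

omit [∀ i, Nonempty (C i)] in
theorem sum_sigma_ite_fst (ρ : (Σ i, C i) → ℝ) (i : I) :
    ∑ x, (if x.1 = i then ρ x else 0) = ∑ a, ρ ⟨i, a⟩ := by
  rw [Fintype.sum_sigma, Finset.sum_eq_single i]
  · simp
  · intro j _ hj
    simp [hj]
  · simp

theorem comp_act_mem_mixedProfiles (A : GameAction G C u) (g : G) {ρ : (Σ i, C i) → ℝ}
    (hρ : ρ ∈ mixedProfiles C) : (fun x => ρ (A.act g x)) ∈ mixedProfiles C := by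
  refine ⟨fun x => hρ.1 _, fun i => ?_⟩
  rw [← sum_sigma_ite_fst (fun x => ρ (A.act g x)), ← hρ.2 (A.actI g i), ← sum_sigma_ite_fst]
  refine Eq.trans ?_ (Function.Bijective.sum_comp (A.act_bijective g) _)
  refine sum_congr rfl fun x _ => ?_
  simp only [show (A.act g x).1 = A.actI g x.1 from rfl, (A.actI_bijective g).1.eq_iff]

omit [Fintype I] [∀ i, Nonempty (C i)] in
theorem convex_mixedProfiles : Convex ℝ (mixedProfiles C) := by
  intro ρ hρ σ hσ a b ha hb hab
  refine ⟨fun x => ?_, fun i => ?_⟩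
  · exact add_nonneg (mul_nonneg ha (hρ.1 x)) (mul_nonneg hb (hσ.1 x))
  · simp only [Pi.add_apply, Pi.smul_apply, smul_eq_mul, sum_add_distrib, ← mul_sum, hρ.2, hσ.2]
    simpa using hab

omit [Fintype I] [∀ i, Nonempty (C i)] in
theorem isCompact_mixedProfiles : IsCompact (mixedProfiles C) := by
  have hclosed : IsClosed (mixedProfiles C) := by
    have : mixedProfiles C = (⋂ x, {ρ | 0 ≤ ρ x}) ∩ ⋂ i, {ρ | ∑ a, ρ ⟨i, a⟩ = 1} := by
      ext ρ
      simp [mixedProfiles]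
    rw [this]
    exact (isClosed_iInter fun x => isClosed_le continuous_const (continuous_apply x)).inter
      (isClosed_iInter fun i => isClosed_eq (by fun_prop) continuous_const)
  refine (isCompact_Icc (a := (0 : (Σ i, C i) → ℝ)) (b := 1)).of_isClosed_subset hclosed ?_
  rintro ρ hρ
  refine ⟨hρ.1, fun x => ?_⟩
  rw [Pi.one_apply, ← hρ.2 x.1]
  exact Finset.single_le_sum (f := fun a => ρ ⟨x.1, a⟩) (fun a _ => hρ.1 _) (mem_univ x.2)

/-- The average of a function over the group. -/
noncomputable def GameAction.average [Fintype G] (A : GameAction G C u) (ρ : (Σ i, C i) → ℝ) :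
    (Σ i, C i) → ℝ :=
  ∑ g : G, (Fintype.card G : ℝ)⁻¹ • fun x => ρ (A.act g x)

omit [Fintype I] [∀ i, Fintype (C i)] in
theorem GameAction.average_act [Fintype G] (A : GameAction G C u) (ρ : (Σ i, C i) → ℝ) (g : G)
    (x : Σ i, C i) : A.average ρ (A.act g x) = A.average ρ x := by
  simp only [GameAction.average, Finset.sum_apply, Pi.smul_apply, ← A.act_mul]
  exact Function.Bijective.sum_comp (Group.mulRight_bijective g)
    (fun h => (Fintype.card G : ℝ)⁻¹ • ρ (A.act h x))

theorem GameAction.average_mem_mixedProfiles [Fintype G] (A : GameAction G C u)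
    {ρ : (Σ i, C i) → ℝ} (hρ : ρ ∈ mixedProfiles C) : A.average ρ ∈ mixedProfiles C :=
  convex_mixedProfiles.sum_mem (fun _ _ => by positivity) (by simp)
    fun g _ => comp_act_mem_mixedProfiles A g hρ

theorem GameAction.sum_mul_average [Fintype G] (A : GameAction G C u) {v : (Σ i, C i) → ℝ}
    (hv : ∀ g x, v (A.act g x) = v x) (ρ : (Σ i, C i) → ℝ) :
    ∑ x, v x * A.average ρ x = ∑ x, v x * ρ x := by
  have hg : ∀ g, ∑ x, v x * ρ (A.act g x) = ∑ x, v x * ρ x := fun g => by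
    rw [← Function.Bijective.sum_comp (A.act_bijective g) fun x => v x * ρ x]
    simp only [hv]
  calc ∑ x, v x * A.average ρ x
      = ∑ g : G, (Fintype.card G : ℝ)⁻¹ * ∑ x, v x * ρ (A.act g x) := by
        simp only [GameAction.average, Finset.sum_apply, Pi.smul_apply, smul_eq_mul, mul_sum]
        rw [sum_comm]
        exact sum_congr rfl fun _ _ => sum_congr rfl fun _ _ => by ring
    _ = ∑ x, v x * ρ x := by simp [hg]

omit [∀ i, Nonempty (C i)] in
theorem move_mem_mixedProfiles {ρ : (Σ i, C i) → ℝ} (hρ : ρ ∈ mixedProfiles C) (i : I)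
    (a b : C i) : ρ + ρ ⟨i, a⟩ • (Pi.single ⟨i, b⟩ 1 - Pi.single ⟨i, a⟩ 1) ∈ mixedProfiles C := by
  refine ⟨fun x => ?_, fun j => ?_⟩
  · have h := hρ.1 x
    have ha := hρ.1 ⟨i, a⟩
    simp only [Pi.add_apply, Pi.smul_apply, Pi.sub_apply, Pi.single_apply, smul_eq_mul]
    split_ifs with h₁ h₂ h₂
    · simpa using h
    · linarith
    · subst h₂
      simp
    · simpa using h
  · have hs : ∀ c : C i, ∑ a, (Pi.single (⟨i, c⟩ : Σ i, C i) (1 : ℝ) : (Σ i, C i) → ℝ) ⟨j, a⟩ =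
        if i = j then 1 else 0 := fun c => by
      rw [← sum_sigma_ite_fst]
      simp only [Pi.single_apply, ← ite_and, and_comm (b := _ = (⟨i, c⟩ : Σ i, C i))]
      simp only [ite_and, sum_ite_eq', mem_univ, if_true]
    simp only [Pi.add_apply, Pi.smul_apply, Pi.sub_apply, smul_eq_mul, sum_add_distrib, ← mul_sum,
      sum_sub_distrib, hs, hρ.2]
    ring

omit [∀ i, Nonempty (C i)] in
theorem continuous_payoffAgainst (x : Σ i, C i) :
    Continuous fun ρ : (Σ i, C i) → ℝ => payoffAgainst u ρ x := by
  unfold payoffAgainst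
  refine continuous_finsetSum _ fun s _ => ?_
  split_ifs <;> fun_prop

/-- A finite game with a group action has an invariant Nash equilibrium in mixed strategies. -/
theorem exists_invariant_equilibrium [Fintype G] (A : GameAction G C u) :
    ∃ ρ ∈ mixedProfiles C, (∀ g x, ρ (A.act g x) = ρ x) ∧ ∀ (i : I) (a b : C i),
      0 ≤ ρ ⟨i, a⟩ * (payoffAgainst u ρ ⟨i, a⟩ - payoffAgainst u ρ ⟨i, b⟩) := by
  have hclosed : IsClosed {ρ : (Σ i, C i) → ℝ | ∀ g x, ρ (A.act g x) = ρ x} := by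
    simp only [Set.ofPred_forall]
    exact isClosed_iInter fun g => isClosed_iInter fun x =>
      isClosed_eq (continuous_apply _) (continuous_apply _)
  have hconv : Convex ℝ {ρ : (Σ i, C i) → ℝ | ∀ g x, ρ (A.act g x) = ρ x} := by
    intro ρ hρ σ hσ a b _ _ _ g x
    simp only [Pi.add_apply, Pi.smul_apply, hρ g x, hσ g x]
  have hne : (mixedProfiles C).Nonempty := by
    refine ⟨fun x => if x.2 = Classical.arbitrary _ then 1 else 0, fun x => ?_, fun i => ?_⟩
    · positivity
    · rw [Finset.sum_eq_single (Classical.arbitrary (C i)) (fun a _ ha => if_neg ha)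
        (fun h => absurd (mem_univ _) h)]
      exact if_pos rfl
  obtain ⟨ρ₀, hρ₀⟩ := hne
  let B : ((Σ i, C i) → ℝ) → ((Σ i, C i) → ℝ) →ₗ[ℝ] ℝ := fun ρ =>
    ∑ x, payoffAgainst u ρ x • LinearMap.proj x
  have hBapp : ∀ ρ σ, B ρ σ = ∑ x, payoffAgainst u ρ x * σ x := fun ρ σ => by
    simp [B, LinearMap.sum_apply]
  have hcont := continuous_payoffAgainst (u := u)
  obtain ⟨ρ, ⟨hρ, hinv⟩, hvar⟩ := exists_variational_inequality
    (isCompact_mixedProfiles.inter_right hclosed) (convex_mixedProfiles.inter hconv)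
    ⟨_, A.average_mem_mixedProfiles hρ₀, fun g x => A.average_act ρ₀ g x⟩ B
    (fun σ => by simp only [hBapp]; fun_prop) (by simp only [hBapp]; fun_prop)
  refine ⟨ρ, hρ, hinv, fun i a b => ?_⟩
  have h := hvar _ ⟨A.average_mem_mixedProfiles (move_mem_mixedProfiles hρ i a b),
    fun g x => A.average_act _ g x⟩
  rw [hBapp, hBapp, A.sum_mul_average (payoffAgainst_act A hinv), ← hBapp, ← hBapp, map_add,
    map_smul, map_sub, hBapp _ (Pi.single _ _), hBapp _ (Pi.single _ _)] at h
  simp only [Pi.single_apply, mul_ite, mul_one, mul_zero, sum_ite_eq', mem_univ, if_true,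
    smul_eq_mul] at h
  linarith

omit [∀ i, Nonempty (C i)] in
theorem sum_deviation_eq (ρ : (Σ i, C i) → ℝ) (i : I) (a b : C i) :
    ∑ q : ∀ j, C j, (if q i = a then
      (∏ k, ρ ⟨k, q k⟩) * (u i q - u i (Function.update q i b)) else 0) =
    ρ ⟨i, a⟩ * (payoffAgainst u ρ ⟨i, a⟩ - payoffAgainst u ρ ⟨i, b⟩) := by
  have hb : payoffAgainst u ρ ⟨i, b⟩ = ∑ q : ∀ j, C j, if q i = a then
      (∏ k ∈ univ.erase i, ρ ⟨k, q k⟩) * u i (Function.update q i b) else 0 := by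
    simp only [payoffAgainst, Sigma.mk.injEq, heq_eq_eq, true_and]
    rw [← sum_filter, ← sum_filter]
    refine Finset.sum_nbij' (fun q => Function.update q i a) (fun q => Function.update q i b)
      ?_ ?_ ?_ ?_ ?_
    · intro q _
      simp
    · intro q _
      simp
    · intro q hq
      simp [← (mem_filter.1 hq).2]
    · intro q hq
      simp [← (mem_filter.1 hq).2]
    · intro q hq
      have hq' : Function.update (Function.update q i a) i b = q := by
        simp [← (mem_filter.1 hq).2]
      rw [hq']
      congr 1
      refine prod_congr rfl fun k hk => ?_
      rw [Function.update_of_ne (ne_of_mem_erase hk)]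
  rw [hb]
  simp only [payoffAgainst, Sigma.mk.injEq, heq_eq_eq, true_and]
  rw [← sum_sub_distrib, mul_sum]
  refine sum_congr rfl fun q _ => ?_
  split_ifs with h
  · rw [← mul_prod_erase univ _ (mem_univ i), h]
    ring
  · simp

end Action

theorem gameValue_uM0_nonpos {I : Type*} [Fintype I] [Nonempty I] {C : I → Type*}
    [∀ i, Fintype (C i)] [∀ i, Nonempty (C i)] (u : ∀ i : I, (∀ j, C j) → ℝ) :
    gameValue (uM0 u) ≤ 0 := by
  refine Real.iSup_le (fun σ => ?_) le_rfl
  let i₀ := Classical.arbitrary I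
  let c := Classical.arbitrary (C i₀)
  let θ : stdSimplex ℝ (Σ i : I, C i × C i) := ⟨Pi.single ⟨i₀, c, c⟩ 1, single_mem_stdSimplex ℝ _⟩
  have hθ : expPay (uM0 u) σ.1 θ.1 = 0 := by
    refine sum_eq_zero fun s _ => sum_eq_zero fun p _ => ?_
    by_cases hp : p = ⟨i₀, c, c⟩
    · subst hp
      by_cases h : c = s i₀
      · simp [uM0, h]
      · simp [uM0, h]
    · simp [θ, hp]
  by_cases hbdd : BddBelow (Set.range fun θ : stdSimplex ℝ (Σ i : I, C i × C i) =>
      expPay (uM0 u) σ.1 θ.1)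
  · exact (ciInf_le hbdd θ).trans hθ.le
  · exact (Real.sInf_of_not_bddBelow hbdd).le

/-- Powers of a mixed strategy profile at which no player gains by deviating are unprofitable to
deviate from in the contracted power. -/
theorem sum_power_mul_uM0_nonneg {I : Type*} [Fintype I] {C : I → Type*} [∀ i, Fintype (C i)]
    (u : ∀ i : I, (∀ j, C j) → ℝ) {ρ : (Σ i, C i) → ℝ} (hρ : ∀ x, 0 ≤ ρ x)
    (heq : ∀ (i : I) (a b : C i),
      0 ≤ ρ ⟨i, a⟩ * (payoffAgainst u ρ ⟨i, a⟩ - payoffAgainst u ρ ⟨i, b⟩))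
    (m : ℕ) (p : Σ i : I, (Fin m → C i) × (Fin m → C i)) :
    0 ≤ ∑ s : ∀ i, Fin m → C i, (∏ i, ∏ j, ρ ⟨i, s i j⟩) *
      uM0 (C := fun i => Fin m → C i) (uTen u m) s p := by
  obtain ⟨i, r, t⟩ := p
  let h : Fin m → Fin m → (∀ k, C k) → ℝ := fun l j q => if q i = r j then
    (∏ k, ρ ⟨k, q k⟩) * (if j = l then u i q - u i (Function.update q i (t j)) else 1) else 0
  have hfactor : ∀ l j, 0 ≤ ∑ q, h l j q := by
    intro l j
    by_cases hjl : j = l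
    · simp only [h, hjl, if_true]
      rw [sum_deviation_eq]
      exact heq _ _ _
    · simp only [h, hjl, if_false, mul_one]
      refine sum_nonneg fun q _ => ?_
      split_ifs
      exacts [prod_nonneg fun k _ => hρ _, le_rfl]
  have hprod : ∀ l, ∑ q : Fin m → ∀ k, C k, ∏ j, h l j (q j) = ∏ j, ∑ q, h l j q := fun l => by
    rw [Finset.prod_univ_sum, Fintype.piFinset_univ]
  have hterm : ∀ q : Fin m → ∀ k, C k, (∏ k, ∏ j, ρ ⟨k, q j k⟩) *
      uM0 (C := fun i => Fin m → C i) (uTen u m) (fun k j => q j k) ⟨i, r, t⟩ =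
      ∑ l, ∏ j, h l j (q j) := by
    intro q
    by_cases hr : r = fun j => q j i
    · have hr' : ∀ j, q j i = r j := fun j => by rw [hr]
      have hup : ∀ j, (fun k => Function.update (β := fun i => Fin m → C i)
          (fun k j => q j k) i t k j) = Function.update (q j) i (t j) := by
        intro j
        funext k
        by_cases hk : k = i
        · subst hk
          simp
        · simp [hk]
      simp only [uM0, uTen, h, hr', hup, if_true, prod_mul_distrib, prod_ite_eq', mem_univ]
      rw [prod_comm, ← sum_sub_distrib, mul_sum]
    · have hl : ∀ l, ∏ j, h l j (q j) = 0 := by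
        intro l
        have : ∃ j, q j i ≠ r j := by
          by_contra! hall
          exact hr (funext fun j => (hall j).symm)
        obtain ⟨j, hj⟩ := this
        exact prod_eq_zero (mem_univ j) (by simp [h, hj])
      simp [uM0, hr, hl]
  rw [← (Equiv.piComm fun (_ : Fin m) (k : I) => C k).sum_comp]
  refine le_of_le_of_eq ?_ (sum_congr rfl fun q _ => (hterm q).symm)
  rw [sum_comm]
  refine sum_nonneg fun l _ => ?_
  rw [hprod]
  exact prod_nonneg fun j _ => hfactor l j

theorem power_mem_powInv {G : Type*} [Group G] {I : Type*} [Fintype I] {C : I → Type*}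
    [∀ i, Nonempty (C i)] {u : ∀ i : I, (∀ j, C j) → ℝ} (A : GameAction G C u)
    {ρ : (Σ i, C i) → ℝ} (hρ : ∀ g x, ρ (A.act g x) = ρ x) (m : ℕ) :
    (fun s : ∀ i, Fin m → C i => ∏ i, ∏ j, ρ ⟨i, s i j⟩) ∈ powInv A m := by
  intro g σ
  funext s
  change ∏ i, ∏ j, ρ ⟨i, powAct A m g σ s i j⟩ = ∏ i, ∏ j, ρ ⟨i, s i j⟩
  have hcopy : ∀ q : ∀ k, C k, ∏ i, ρ ⟨i, A.actS g q i⟩ = ∏ i, ρ ⟨i, q i⟩ := by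
    intro q
    rw [← Function.Bijective.prod_comp (A.actI_bijective g)]
    refine prod_congr rfl fun i _ => ?_
    rw [← hρ g ⟨i, q i⟩, A.act_mk]
  rw [prod_comm, prod_comm (f := fun i j => ρ ⟨i, s i j⟩)]
  simp only [powAct, hcopy]
  exact Equiv.prod_comp σ⁻¹ fun j => ∏ i, ρ ⟨i, s i j⟩

/-- The `(G×S_m)`-invariant product distributions of the `m`-th power `Γ^{Πm}` form a
good set in the auxiliary zero-sum game `(Γ^{⊗m})⁰` of the contracted `m`-th power. -/
theorem invariant_power_products_good
    {G : Type*} [Group G] [Fintype G]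
    {I : Type*} [Fintype I] {C : I → Type*} [∀ i, Fintype (C i)]
    (hI : 2 ≤ Fintype.card I) (hC : ∀ i, 2 ≤ Fintype.card (C i))
    (u : ∀ i : I, (∀ j, C j) → ℝ) (A : GameAction G C u) (m : ℕ) :
    IsGood (uM0 (C := fun i => Fin m → C i) (uTen u m))
      (prodPow C m ∩ powInv A m) := by
  have : Nonempty I := Fintype.card_pos_iff.1 (by omega)
  have : ∀ i, Nonempty (C i) := fun i => Fintype.card_pos_iff.1 (by have := hC i; omega)
  obtain ⟨ρ, hρ, hinv, heq⟩ := exists_invariant_equilibrium A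
  intro θ hθ
  refine ⟨_, ⟨⟨fun i _ a => ρ ⟨i, a⟩, fun i _ => ⟨fun a => hρ.1 _, hρ.2 i⟩, rfl⟩,
    power_mem_powInv A hinv m⟩, ?_⟩
  refine (gameValue_uM0_nonpos _).trans ?_
  rw [expPay, sum_comm]
  refine sum_nonneg fun p _ => ?_
  refine le_of_le_of_eq (mul_nonneg (hθ.1 p) (sum_power_mul_uM0_nonneg u hρ.1 heq m p)) ?_
  rw [mul_sum]
  exact sum_congr rfl fun s _ => by ring
end

section
/- If a finite group G acts on the finite game Γ, then for every m ∈ ℕ the set of order m G-exchangeable equilibria XE_G^m(Γ) = Δ^X_{G×S_m}(Γ^{Πm}) ∩ CE_{G×S_m}(Γ^{⊗m}) is nonempty. -/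
open Finset
open scoped Classical BigOperators

/-- Correlated equilibria of the contracted `m`-th power `Γ^{⊗m}`:
player `i` may deviate based on the whole recommendation `s i`. -/
def ceTen {I : Type*} [Fintype I] {C : I → Type*} [∀ i, Fintype (C i)]
    (u : ∀ i : I, (∀ j, C j) → ℝ) (m : ℕ) : Set ((∀ i, Fin m → C i) → ℝ) :=
  {π | π ∈ stdSimplex ℝ (∀ i, Fin m → C i) ∧
    ∀ (i : I) (r t : Fin m → C i),
      ∑ s : ∀ k, Fin m → C k,
        (if s i = r then (uTen u m i (Function.update s i t) - uTen u m i s) * π s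
         else 0) ≤ 0}

/-! ### Scarf's lemma for families of linear orders -/

/-- With the linear orders on `T` indexed by `I` given by the rank functions `r i`, no point of `T`
lies above all of `σ`'s `i`-minima simultaneously for every `i ∈ D`. -/
def IsDominant {I T : Type*} (r : I → T → ℕ) (σ : Finset T) (D : Finset I) : Prop :=
  ∀ y, ∃ i ∈ D, ∀ x ∈ σ, r i y ≤ r i x

section Scarf

variable {I T : Type*} {r : I → T → ℕ}

theorem IsDominant.mono {σ τ : Finset T} {C D : Finset I} (h : IsDominant r σ C)
    (hτ : τ ⊆ σ) (hD : C ⊆ D) : IsDominant r τ D := fun y =>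
  let ⟨i, hi, hx⟩ := h y
  ⟨i, hD hi, fun x hxτ => hx x (hτ hxτ)⟩

theorem IsDominant.image_eq (hr : ∀ i, Function.Injective (r i)) {τ : Finset T} {D : Finset I}
    {m : I → T} (hm : ∀ i, m i ∈ τ ∧ ∀ x ∈ τ, r i (m i) ≤ r i x) (h : IsDominant r τ D) :
    D.image m = τ := by
  ext x
  rw [mem_image]
  constructor
  · rintro ⟨i, -, rfl⟩
    exact (hm i).1
  · intro hx
    obtain ⟨i, hi, hix⟩ := h x
    exact ⟨i, hi, hr i (le_antisymm ((hm i).2 x hx) (hix _ (hm i).1))⟩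

/-- The room `ρ` is obtained from the door `(τ, D)` by giving up the index `k`: either `k` is
removed from `D`, or a point lying below `τ` only in the `k`-th order is added to `τ`. -/
def IsAdjacent (r : I → T → ℕ) (m : I → T) (τ : Finset T) (D : Finset I) (k : I)
    (ρ : Finset T × Finset I) : Prop :=
  ρ = (τ, D.erase k) ∨ ∃ x ∉ τ, ρ = (insert x τ, D) ∧
    (∀ j ∈ D, j ≠ k → r j (m j) < r j x) ∧ r k x < r k (m k)

theorem subset_subset_cases {α β : Type*} {σ τ : Finset α} {C D : Finset β} (hσ : #σ = #C)
    (hD : #D = #τ + 1) (h₁ : τ ⊆ σ) (h₂ : C ⊆ D) :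
    (σ = τ ∧ ∃ k ∈ D, C = D.erase k) ∨ (C = D ∧ ∃ x ∉ τ, σ = insert x τ) := by
  have h₃ := card_le_card h₁
  have h₄ := card_le_card h₂
  rcases Nat.eq_or_lt_of_le h₃ with h | h
  · left
    refine ⟨(eq_of_subset_of_card_le h₁ h.ge).symm, ?_⟩
    obtain ⟨k, hk, hkD⟩ := (covBy_iff_exists_insert (s := C) (t := D)).1
      (covBy_iff_card_sdiff_eq_one.2 ⟨h₂, by rw [card_sdiff_of_subset h₂]; omega⟩)
    subst hkD
    exact ⟨k, mem_insert_self _ _, (erase_insert hk).symm⟩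
  · right
    refine ⟨eq_of_subset_of_card_le h₂ (by omega), ?_⟩
    obtain ⟨k, hk, hkD⟩ := (covBy_iff_exists_insert (s := τ) (t := σ)).1
      (covBy_iff_card_sdiff_eq_one.2 ⟨h₁, by rw [card_sdiff_of_subset h₁]; omega⟩)
    exact ⟨k, hk, hkD.symm⟩

theorem exists_isAdjacent (hr : ∀ i, Function.Injective (r i)) {τ : Finset T} {D : Finset I}
    {m : I → T} (hm : ∀ i, m i ∈ τ ∧ ∀ x ∈ τ, r i (m i) ≤ r i x) (hcard : #D = #τ + 1)
    {ρ : Finset T × Finset I} (hρ : IsDominant r ρ.1 ρ.2) (hρc : #ρ.1 = #ρ.2)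
    (h₁ : τ ⊆ ρ.1) (h₂ : ρ.2 ⊆ D) :
    ∃ k ∈ D, (D.erase k).image m = τ ∧ IsAdjacent r m τ D k ρ := by
  obtain ⟨σ, C⟩ := ρ
  simp only at hρ hρc h₁ h₂
  rcases subset_subset_cases hρc hcard h₁ h₂ with ⟨rfl, k, hk, rfl⟩ | ⟨rfl, x, hx, rfl⟩
  · exact ⟨k, hk, hρ.image_eq hr hm, Or.inl rfl⟩
  · obtain ⟨k, hk, hkx⟩ := hρ x
    have hlt : r k x < r k (m k) :=
      lt_of_le_of_ne (hkx _ (mem_insert_of_mem (hm k).1))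
        fun h => hx (hr k h ▸ (hm k).1)
    have hmin : ∀ z ∈ τ, ∃ i ∈ C.erase k, m i = z ∧ r i z ≤ r i x := by
      intro z hz
      obtain ⟨i, hi, hiz⟩ := hρ z
      have hik : i ≠ k := by
        rintro rfl
        have h₃ := hiz x (mem_insert_self _ _)
        have h₄ := (hm i).2 z hz
        omega
      exact ⟨i, mem_erase.2 ⟨hik, hi⟩,
        hr i (le_antisymm ((hm i).2 z hz) (hiz _ (mem_insert_of_mem (hm i).1))),
        hiz x (mem_insert_self _ _)⟩
    have himg : (C.erase k).image m = τ := by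
      ext z
      rw [mem_image]
      constructor
      · rintro ⟨i, -, rfl⟩
        exact (hm i).1
      · intro hz
        obtain ⟨i, hi, hiz, -⟩ := hmin z hz
        exact ⟨i, hi, hiz⟩
    have hinj : Set.InjOn m (C.erase k) := by
      rw [← card_image_iff, himg, card_erase_of_mem hk, hcard, Nat.add_sub_cancel]
    refine ⟨k, hk, himg, Or.inr ⟨x, hx, rfl, fun j hj hjk => ?_, hlt⟩⟩
    obtain ⟨i, hi, hij, hix⟩ := hmin (m j) (hm j).1
    obtain rfl := hinj hi (mem_erase.2 ⟨hjk, hj⟩) hij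
    exact lt_of_le_of_ne hix fun h => hx (hr i h ▸ (hm i).1)

theorem existsUnique_isAdjacent [Fintype T] (hr : ∀ i, Function.Injective (r i)) {τ : Finset T}
    {D : Finset I} {m : I → T} (hm : ∀ i, m i ∈ τ ∧ ∀ x ∈ τ, r i (m i) ≤ r i x)
    (hcard : #D = #τ + 1) (hdom : IsDominant r τ D) {k : I} (hk : k ∈ D)
    (himg : (D.erase k).image m = τ) :
    ∃! ρ : Finset T × Finset I,
      (IsDominant r ρ.1 ρ.2 ∧ #ρ.1 = #ρ.2) ∧ IsAdjacent r m τ D k ρ := by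
  by_cases hY : ∃ y, ∀ j ∈ D, j ≠ k → r j (m j) < r j y
  · obtain ⟨x, hx, hmax⟩ := exists_max_image
      (univ.filter fun y => ∀ j ∈ D, j ≠ k → r j (m j) < r j y) (r k)
      (hY.imp fun y hy => by simpa using hy)
    simp only [mem_filter, mem_univ, true_and] at hx hmax
    have hxτ : x ∉ τ := by
      rw [← himg, mem_image]
      rintro ⟨j, hj, rfl⟩
      rw [mem_erase] at hj
      exact lt_irrefl _ (hx j hj.2 hj.1)
    have hxk : r k x < r k (m k) := by
      obtain ⟨i, hi, hix⟩ := hdom x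
      by_cases hik : i = k
      · subst hik
        exact lt_of_le_of_ne (hix _ (hm i).1) fun h => hxτ (hr i h ▸ (hm i).1)
      · exact absurd (hix _ (hm i).1) (not_le.2 (hx i hi hik))
    refine ⟨(insert x τ, D), ⟨⟨fun y => ?_, ?_⟩, Or.inr ⟨x, hxτ, rfl, hx, hxk⟩⟩, ?_⟩
    · by_cases hy : ∀ j ∈ D, j ≠ k → r j (m j) < r j y
      · refine ⟨k, hk, fun z hz => (hmax y hy).trans ?_⟩
        rcases mem_insert.1 hz with rfl | hz
        · exact le_rfl
        · exact hxk.le.trans ((hm k).2 z hz)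
      · push Not at hy
        obtain ⟨j, hj, hjk, hle⟩ := hy
        refine ⟨j, hj, fun z hz => hle.trans ?_⟩
        rcases mem_insert.1 hz with rfl | hz
        · exact (hx j hj hjk).le
        · exact (hm j).2 z hz
    · simp [card_insert_of_notMem hxτ, hcard]
    · rintro ρ ⟨⟨hρ, -⟩, rfl | ⟨x', hx', rfl, hj', hk'⟩⟩
      · obtain ⟨i, hi, hix⟩ := hρ x
        rw [mem_erase] at hi
        exact absurd (hix _ (hm i).1) (not_le.2 (hx i hi.2 hi.1))
      · obtain ⟨i, hi, hix⟩ := hρ x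
        have hik : i = k := by
          by_contra hik
          exact absurd (hix _ (mem_insert_of_mem (hm i).1)) (not_le.2 (hx i hi hik))
        subst hik
        rw [hr i (le_antisymm (hix _ (mem_insert_self _ _)) (hmax x' hj'))]
  · refine ⟨(τ, D.erase k), ⟨⟨fun y => ?_, ?_⟩, Or.inl rfl⟩, ?_⟩
    · push Not at hY
      obtain ⟨j, hj, hjk, hle⟩ := hY y
      exact ⟨j, mem_erase.2 ⟨hjk, hj⟩, fun x hx => hle.trans ((hm j).2 x hx)⟩
    · simp [card_erase_of_mem hk, hcard]
    · rintro ρ ⟨-, rfl | ⟨x, -, -, hx, -⟩⟩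
      · rfl
      · exact absurd ⟨x, hx⟩ hY

theorem IsAdjacent.index_unique {τ : Finset T} {D : Finset I} {m : I → T} {k l : I} (hk : k ∈ D)
    {ρ : Finset T × Finset I} (h : IsAdjacent r m τ D k ρ)
    (h' : IsAdjacent r m τ D l ρ) : k = l := by
  by_contra hkl
  rcases h with rfl | ⟨x, hx, rfl, hj, hk'⟩ <;> rcases h' with h' | ⟨y, hy, h', hj', hl'⟩
  · rw [Prod.mk.injEq] at h'
    exact notMem_erase k D (h'.2 ▸ mem_erase.2 ⟨hkl, hk⟩)
  · rw [Prod.mk.injEq] at h'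
    exact hy (h'.1 ▸ mem_insert_self _ _)
  · rw [Prod.mk.injEq] at h'
    exact hx (h'.1 ▸ mem_insert_self _ _)
  · rw [Prod.mk.injEq] at h'
    have hxy : x = y := (mem_insert.1 (h'.1 ▸ mem_insert_self x τ)).resolve_right hx
    subst hxy
    exact lt_asymm hk' (hj' k hk hkl)

theorem even_card_rooms_of_door [Fintype I] [Fintype T] (hr : ∀ i, Function.Injective (r i))
    {τ : Finset T} {D : Finset I} (hτ : τ.Nonempty) (hcard : #D = #τ + 1)
    (hdom : IsDominant r τ D) :
    Even #{ρ : Finset T × Finset I |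
      (IsDominant r ρ.1 ρ.2 ∧ #ρ.1 = #ρ.2) ∧ τ ⊆ ρ.1 ∧ ρ.2 ⊆ D} := by
  choose m hm using fun i => exists_min_image τ (r i) hτ
  obtain ⟨i₁, h₁, i₂, h₂, hne, heq⟩ := exists_ne_map_eq_of_card_lt_of_maps_to
    (show #τ < #D by omega) (f := m) fun i _ => (hm i).1
  have himg : ∀ i ∈ D, ∀ j ∈ D, i ≠ j → m i = m j → (D.erase i).image m = τ := by
    intro i hi j hj hij hmij
    rw [← hdom.image_eq hr hm]
    refine (image_subset_image (erase_subset _ _)).antisymm fun x hx => ?_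
    obtain ⟨k, hk, rfl⟩ := mem_image.1 hx
    by_cases hki : k = i
    · subst hki
      exact mem_image.2 ⟨j, mem_erase.2 ⟨hij.symm, hj⟩, hmij.symm⟩
    · exact mem_image_of_mem _ (mem_erase.2 ⟨hki, hk⟩)
  obtain ⟨ρ₁, ⟨hρ₁, ha₁⟩, hu₁⟩ :=
    existsUnique_isAdjacent hr hm hcard hdom h₁ (himg i₁ h₁ i₂ h₂ hne heq)
  obtain ⟨ρ₂, ⟨hρ₂, ha₂⟩, hu₂⟩ :=
    existsUnique_isAdjacent hr hm hcard hdom h₂ (himg i₂ h₂ i₁ h₁ hne.symm heq.symm)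
  have hsub : ∀ k ρ, IsAdjacent r m τ D k ρ → τ ⊆ ρ.1 ∧ ρ.2 ⊆ D := by
    rintro k ρ (rfl | ⟨x, -, rfl, -, -⟩)
    · exact ⟨Subset.rfl, erase_subset _ _⟩
    · exact ⟨subset_insert _ _, Subset.rfl⟩
  have hset : ({ρ : Finset T × Finset I |
      (IsDominant r ρ.1 ρ.2 ∧ #ρ.1 = #ρ.2) ∧ τ ⊆ ρ.1 ∧ ρ.2 ⊆ D} : Finset _) = {ρ₁, ρ₂} := by
    ext ρ
    simp only [mem_filter, mem_univ, true_and, mem_insert, mem_singleton]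
    constructor
    · rintro ⟨hρ, hs₁, hs₂⟩
      obtain ⟨k, hk, hkτ, hadj⟩ := exists_isAdjacent hr hm hcard hρ.1 hρ.2 hs₁ hs₂
      have hinj : Set.InjOn m (D.erase k) := by
        rw [← card_image_iff, hkτ, card_erase_of_mem hk, hcard, Nat.add_sub_cancel]
      by_cases hk₁ : k = i₁
      · exact Or.inl (hu₁ ρ ⟨hρ, hk₁ ▸ hadj⟩)
      · by_cases hk₂ : k = i₂
        · exact Or.inr (hu₂ ρ ⟨hρ, hk₂ ▸ hadj⟩)
        · exact absurd (hinj (mem_erase.2 ⟨Ne.symm hk₁, h₁⟩) (mem_erase.2 ⟨Ne.symm hk₂, h₂⟩) heq)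
            hne
    · rintro (rfl | rfl)
      · exact ⟨hρ₁, hsub _ _ ha₁⟩
      · exact ⟨hρ₂, hsub _ _ ha₂⟩
  rw [hset, card_pair]
  · exact even_two
  · rintro rfl
    exact hne (ha₁.index_unique h₁ ha₂)

theorem card_rooms_of_empty_door [Fintype I] [Fintype T] [Nonempty T]
    (hr : ∀ i, Function.Injective (r i)) (i₀ : I) :
    #{ρ : Finset T × Finset I |
      (IsDominant r ρ.1 ρ.2 ∧ #ρ.1 = #ρ.2) ∧ ∅ ⊆ ρ.1 ∧ ρ.2 ⊆ {i₀}} = 1 := by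
  obtain ⟨x, -, hx⟩ := exists_max_image (univ : Finset T) (r i₀) univ_nonempty
  rw [card_eq_one]
  refine ⟨({x}, {i₀}), ?_⟩
  ext ⟨σ, C⟩
  simp only [mem_filter, mem_univ, true_and, mem_singleton, empty_subset, Prod.mk.injEq,
    subset_singleton_iff]
  constructor
  · rintro ⟨⟨hdom, hcard⟩, rfl | rfl⟩
    · obtain ⟨i, hi, -⟩ := hdom x
      exact absurd hi (notMem_empty i)
    · rw [card_singleton, card_eq_one] at hcard
      obtain ⟨y, rfl⟩ := hcard
      obtain ⟨i, hi, hix⟩ := hdom x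
      rw [mem_singleton] at hi
      subst hi
      rw [hr i (le_antisymm (hx y (mem_univ _)) (hix y (mem_singleton_self _)))]
      exact ⟨rfl, rfl⟩
  · rintro ⟨rfl, rfl⟩
    refine ⟨⟨fun y => ⟨i₀, mem_singleton_self _, fun z hz => ?_⟩, by simp⟩, Or.inr rfl⟩
    rw [mem_singleton.1 hz]
    exact hx y (mem_univ _)

theorem even_card_doors_of_room [Fintype I] [Fintype T] (c : T → I) (i₀ : I) {σ : Finset T}
    {C : Finset I} (hdom : IsDominant r σ C) (hcard : #σ = #C) (hc : σ.image c ≠ C) :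
    Even #{d : Finset T × Finset I |
      (IsDominant r d.1 d.2 ∧ #d.2 = #d.1 + 1 ∧ d.2 = insert i₀ (d.1.image c)) ∧
        d.1 ⊆ σ ∧ C ⊆ d.2} := by
  have hiff : ∀ d : Finset T × Finset I,
      ((IsDominant r d.1 d.2 ∧ #d.2 = #d.1 + 1 ∧ d.2 = insert i₀ (d.1.image c)) ∧
        d.1 ⊆ σ ∧ C ⊆ d.2) ↔
      ((∃ i ∉ C, d = (σ, insert i C) ∧ insert i C = insert i₀ (σ.image c)) ∨
        ∃ x ∈ σ, d = (σ.erase x, C) ∧ C = insert i₀ ((σ.erase x).image c)) := by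
    rintro ⟨τ, D⟩
    constructor
    · rintro ⟨⟨-, hD, hDc⟩, h₁, h₂⟩
      rcases subset_subset_cases hcard hD h₁ h₂ with ⟨rfl, k, hk, rfl⟩ | ⟨rfl, x, hx, rfl⟩
      · refine Or.inl ⟨k, notMem_erase _ _, ?_⟩
        rw [insert_erase hk]
        exact ⟨rfl, hDc⟩
      · refine Or.inr ⟨x, mem_insert_self _ _, ?_⟩
        rw [erase_insert hx]
        exact ⟨rfl, hDc⟩
    · rintro (⟨i, hi, hd, hE⟩ | ⟨x, hx, hd, hE⟩) <;> rw [Prod.mk.injEq] at hd <;>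
        obtain ⟨rfl, rfl⟩ := hd
      · exact ⟨⟨hdom.mono Subset.rfl (subset_insert _ _), by simp [card_insert_of_notMem hi, hcard],
          hE⟩, Subset.rfl, subset_insert _ _⟩
      · refine ⟨⟨hdom.mono (erase_subset _ _) Subset.rfl, ?_, hE⟩, erase_subset _ _, Subset.rfl⟩
        simp only
        rw [card_erase_add_one hx, hcard]
  simp only [hiff]
  have key : ∀ x ∈ σ, C = insert i₀ ((σ.erase x).image c) →
      Set.InjOn c (σ.erase x) ∧ i₀ ∉ (σ.erase x).image c := by
    intro x hx hC
    have h₁ := card_insert_le i₀ ((σ.erase x).image c)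
    have h₂ : #((σ.erase x).image c) ≤ #(σ.erase x) := card_image_le
    have h₃ := card_erase_add_one hx
    rw [← hC] at h₁
    refine ⟨card_image_iff.1 (by omega), fun h => ?_⟩
    rw [insert_eq_self.2 h] at hC
    rw [← hC] at h₂
    omega
  by_cases h : ∃ i ∉ C, insert i C = insert i₀ (σ.image c)
  · obtain ⟨i, hi, hiC⟩ := h
    have hEc : #(insert i₀ (σ.image c)) = #σ + 1 := by
      rw [← hiC, card_insert_of_notMem hi, hcard]
    have h₁ := card_insert_le i₀ (σ.image c)
    have h₂ : #(σ.image c) ≤ #σ := card_image_le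
    have hinj : Set.InjOn c σ := card_image_iff.1 (by omega)
    have hi₀ : i₀ ∉ σ.image c := fun h => by
      rw [insert_eq_self.2 h] at hEc
      omega
    have hne : i ≠ i₀ := by
      rintro rfl
      apply hc
      rw [← erase_insert hi₀, ← hiC, erase_insert hi]
    have hiσ : i ∈ σ.image c :=
      (mem_insert.1 (hiC ▸ mem_insert_self i C)).resolve_left hne
    obtain ⟨x, hx, rfl⟩ := mem_image.1 hiσ
    have himg : ∀ y ∈ σ, (σ.erase y).image c = (σ.image c).erase (c y) := by
      intro y hy
      ext j
      simp only [mem_image, mem_erase]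
      constructor
      · rintro ⟨z, ⟨hzy, hz⟩, rfl⟩
        exact ⟨fun h => hzy (hinj hz hy h), z, hz, rfl⟩
      · rintro ⟨hj, z, hz, rfl⟩
        exact ⟨z, ⟨fun h => hj (h ▸ rfl), hz⟩, rfl⟩
    have hxC : C = insert i₀ ((σ.erase x).image c) := by
      rw [himg x hx, ← erase_insert_of_ne hne.symm, ← hiC, erase_insert hi]
    have hset : ({d : Finset T × Finset I |
        ((∃ i ∉ C, d = (σ, insert i C) ∧ insert i C = insert i₀ (σ.image c)) ∨
        ∃ x ∈ σ, d = (σ.erase x, C) ∧ C = insert i₀ ((σ.erase x).image c))} : Finset _) =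
        {(σ, insert (c x) C), (σ.erase x, C)} := by
      ext d
      simp only [mem_filter, mem_univ, true_and, mem_insert, mem_singleton]
      constructor
      · rintro (⟨j, hj, rfl, hjC⟩ | ⟨y, hy, rfl, hyC⟩)
        · rw [hiC, hjC]
          exact Or.inl rfl
        · right
          have hyx : c y = c x := by
            by_contra hyx
            have : c x ∈ C := by
              rw [hyC, himg y hy]
              exact mem_insert_of_mem (mem_erase.2 ⟨fun h => hyx h.symm, hiσ⟩)
            exact hi this
          rw [hinj hy hx hyx]
      · rintro (rfl | rfl)
        · exact Or.inl ⟨_, hi, rfl, hiC⟩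
        · exact Or.inr ⟨x, hx, rfl, hxC⟩
    rw [hset, card_pair]
    · exact even_two
    · intro h
      rw [Prod.mk.injEq] at h
      exact hi (h.2 ▸ mem_insert_self _ _)
  by_cases h' : ∃ x ∈ σ, C = insert i₀ ((σ.erase x).image c)
  · obtain ⟨x, hx, hxC⟩ := h'
    have hσ : σ.image c = insert (c x) ((σ.erase x).image c) := by
      rw [← image_insert, insert_erase hx]
    have hcx : c x ∈ C := by
      by_contra hcx
      refine h ⟨c x, hcx, ?_⟩
      rw [hσ, insert_comm, ← hxC]
    have hcx₀ : c x ≠ i₀ := by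
      intro h₀
      rw [h₀, ← hxC] at hσ
      exact hc hσ
    rw [hxC] at hcx
    obtain ⟨y, hy, hyx⟩ := mem_image.1 ((mem_insert.1 hcx).resolve_left hcx₀)
    rw [mem_erase] at hy
    have hyC : C = insert i₀ ((σ.erase y).image c) := by
      rw [hxC]
      congr 1
      ext j
      simp only [mem_image, mem_erase]
      constructor
      · rintro ⟨z, ⟨hzx, hz⟩, rfl⟩
        by_cases hzy : z = y
        · exact ⟨x, ⟨hy.1.symm, hx⟩, by rw [hzy, hyx]⟩
        · exact ⟨z, ⟨hzy, hz⟩, rfl⟩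
      · rintro ⟨z, ⟨hzy, hz⟩, rfl⟩
        by_cases hzx : z = x
        · exact ⟨y, hy, by rw [hzx, hyx]⟩
        · exact ⟨z, ⟨hzx, hz⟩, rfl⟩
    have hset : ({d : Finset T × Finset I |
        ((∃ i ∉ C, d = (σ, insert i C) ∧ insert i C = insert i₀ (σ.image c)) ∨
        ∃ x ∈ σ, d = (σ.erase x, C) ∧ C = insert i₀ ((σ.erase x).image c))} : Finset _) =
        {(σ.erase x, C), (σ.erase y, C)} := by
      ext d
      simp only [mem_filter, mem_univ, true_and, mem_insert, mem_singleton]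
      constructor
      · rintro (⟨j, hj, -, hjC⟩ | ⟨z, hz, rfl, hzC⟩)
        · exact absurd ⟨j, hj, hjC⟩ h
        · by_cases hzx : z = x
          · exact Or.inl (by rw [hzx])
          by_cases hzy : z = y
          · exact Or.inr (by rw [hzy])
          exact absurd ((key z hz hzC).1 (mem_erase.2 ⟨Ne.symm hzy, hy.2⟩)
            (mem_erase.2 ⟨Ne.symm hzx, hx⟩) hyx) hy.1
      · rintro (rfl | rfl)
        · exact Or.inr ⟨x, hx, rfl, hxC⟩
        · exact Or.inr ⟨y, hy.2, rfl, hyC⟩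
    rw [hset, card_pair]
    · exact even_two
    · intro h
      rw [Prod.mk.injEq] at h
      exact notMem_erase y σ (h.1 ▸ mem_erase.2 ⟨hy.1, hy.2⟩)
  · rw [filter_false_of_mem]
    · simp
    · rintro d - (⟨j, hj, -, hjC⟩ | ⟨z, hz, -, hzC⟩)
      · exact h ⟨j, hj, hjC⟩
      · exact h' ⟨z, hz, hzC⟩

/-- **Scarf's lemma**: every colouring of `T` by `I` admits a dominant pair whose points carry
exactly the colours of its index set. -/
theorem exists_isDominant_image_eq [Fintype I] [Nonempty I] [Fintype T] [Nonempty T]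
    (hr : ∀ i, Function.Injective (r i)) (c : T → I) :
    ∃ σ : Finset T, IsDominant r σ (σ.image c) := by
  by_contra! hno
  obtain ⟨i₀⟩ := ‹Nonempty I›
  let doors : Finset (Finset T × Finset I) :=
    {d | IsDominant r d.1 d.2 ∧ #d.2 = #d.1 + 1 ∧ d.2 = insert i₀ (d.1.image c)}
  let rooms : Finset (Finset T × Finset I) := {ρ | IsDominant r ρ.1 ρ.2 ∧ #ρ.1 = #ρ.2}
  let inc : Finset T × Finset I → Finset T × Finset I → Prop := fun d ρ => d.1 ⊆ ρ.1 ∧ ρ.2 ⊆ d.2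
  have hcount := sum_card_bipartiteAbove_eq_sum_card_bipartiteBelow (s := doors) (t := rooms) inc
  have hrooms : Even (∑ ρ ∈ rooms, #(doors.bipartiteBelow inc ρ)) := by
    refine even_sum _ fun ρ hρ => ?_
    simp only [rooms, mem_filter, mem_univ, true_and] at hρ
    have := even_card_doors_of_room c i₀ hρ.1 hρ.2 fun h => hno ρ.1 (h ▸ hρ.1)
    simpa only [bipartiteBelow, doors, filter_filter] using this
  have hmem : ((∅, {i₀}) : Finset T × Finset I) ∈ doors := by
    simp only [doors, mem_filter, mem_univ, true_and]
    exact ⟨fun _ => ⟨i₀, mem_singleton_self _, fun x hx => absurd hx (notMem_empty x)⟩, by simp,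
      rfl⟩
  have hdoors : Even (∑ d ∈ doors.erase (∅, {i₀}), #(rooms.bipartiteAbove inc d)) := by
    refine even_sum _ fun d hd => ?_
    simp only [doors, mem_erase, mem_filter, mem_univ, true_and] at hd
    obtain ⟨hne, hdom, hcard, himg⟩ := hd
    have hτ : d.1.Nonempty := by
      rw [nonempty_iff_ne_empty]
      intro h
      apply hne
      ext1
      · exact h
      · rw [himg, h]; rfl
    have := even_card_rooms_of_door hr hτ hcard hdom
    simpa only [bipartiteAbove, rooms, filter_filter] using this
  have hone : #(rooms.bipartiteAbove inc (∅, {i₀})) = 1 := by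
    have := card_rooms_of_empty_door hr i₀
    simpa only [bipartiteAbove, rooms, filter_filter] using this
  rw [← add_sum_erase _ _ hmem, hone] at hcount
  rw [← hcount, add_comm] at hrooms
  exact Nat.not_even_iff_odd.2 hdoors.add_one hrooms

end Scarf

/-! ### Equilibria of population games -/

section Population

variable {S : Type*} [Fintype S]

/-- A dominant pair of lattice points of the dilated simplex has small diameter. -/
theorem lattice_bounds {N K : ℕ} (e : (S → ℕ) → ℕ) (he : ∀ x, e x < K) {σ : Finset (S → ℕ)}
    (hσ : ∀ x ∈ σ, ∑ k, x k = N) (hne : σ.Nonempty) {C : Finset S}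
    (hdom : ∀ y : S → ℕ, ∑ k, y k = N →
      ∃ i ∈ C, ∀ x ∈ σ, y i * K + e y ≤ x i * K + e x) :
    (∀ x ∈ σ, ∀ k ∉ C, x k ≤ Fintype.card S) ∧
      ∀ x ∈ σ, ∀ z ∈ σ, ∀ k, z k ≤ x k + Fintype.card S := by
  choose a haσ ha using fun k : S => exists_min_image σ (fun x => x k) hne
  obtain ⟨x₀, hx₀⟩ := hne
  obtain ⟨i₁, hi₁, -⟩ := hdom x₀ (hσ x₀ hx₀)
  have hC : #C ≤ Fintype.card S := card_le_univ C
  have hlarge : N < ∑ k ∈ C, (a k k + 1) := by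
    by_contra! hle
    obtain ⟨i, hi, hix⟩ := hdom
      (fun k => (if k ∈ C then a k k + 1 else 0) +
        if k = i₁ then N - ∑ k ∈ C, (a k k + 1) else 0) (by
          rw [sum_add_distrib, ← sum_filter, filter_mem_eq_inter, univ_inter]
          simp only [sum_ite_eq', mem_univ, if_true]
          omega)
    set y : S → ℕ := fun k => (if k ∈ C then a k k + 1 else 0) +
        if k = i₁ then N - ∑ k ∈ C, (a k k + 1) else 0 with hy
    have h : y i * K + e y ≤ a i i * K + e (a i) := hix (a i) (haσ i)
    have hyi : a i i + 1 ≤ y i := by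
      simp only [hy, hi, if_true]
      omega
    have := he (a i)
    have := Nat.mul_le_mul_right K hyi
    rw [Nat.succ_mul] at this
    omega
  rw [sum_add_distrib, sum_const, smul_eq_mul, mul_one] at hlarge
  have hsum : ∀ x ∈ σ, ∑ k ∈ C, x k + ∑ k ∈ Cᶜ, x k = N := fun x hx => by
    rw [sum_add_sum_compl, hσ x hx]
  have hmin : ∀ x ∈ σ, ∑ k ∈ C, a k k ≤ ∑ k ∈ C, x k := fun x hx =>
    sum_le_sum fun k _ => ha k x hx
  have hout : ∀ x ∈ σ, ∀ k ∉ C, x k ≤ Fintype.card S := by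
    intro x hx k hk
    have h₁ := single_le_sum (f := x) (fun _ _ => Nat.zero_le _) (mem_compl.2 hk)
    have h₂ := hsum x hx
    have h₃ := hmin x hx
    omega
  refine ⟨hout, fun x hx z hz k => ?_⟩
  by_cases hk : k ∈ C
  · have h₁ : ∑ j ∈ C.erase k, a j j ≤ ∑ j ∈ C.erase k, z j := sum_le_sum fun j _ => ha j z hz
    have h₂ := hsum z hz
    have h₃ := add_sum_erase C z hk
    have h₄ := add_sum_erase C (fun j => a j j) hk
    have h₅ := ha k x hx
    omega
  · exact (hout z hz k hk).trans (Nat.le_add_left _ _)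

/-- On the lattice of mesh `1 / N`, every payoff vector field on the simplex has a point each of
whose substantial coordinates is optimal at some nearby point. -/
theorem exists_approximate_equilibrium [Nonempty S] (v : (S → ℝ) → S → ℝ) {N : ℕ} (hN : 0 < N) :
    ∃ x ∈ stdSimplex ℝ S, ∀ s, x s ≤ Fintype.card S / N ∨
      ∃ z ∈ stdSimplex ℝ S, (∀ k, |z k - x k| ≤ Fintype.card S / N) ∧ ∀ t, v z t ≤ v z s := by
  let L : Finset (S → ℕ) := piAntidiag univ N
  have hL : ∀ x, x ∈ L ↔ ∑ k, x k = N := fun x => by simp [L, mem_piAntidiag]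
  have hLne : Nonempty L := by
    obtain ⟨s⟩ := ‹Nonempty S›
    exact ⟨⟨Pi.single s N, (hL _).2 (by simp)⟩⟩
  let e : L ≃ Fin (Fintype.card L) := Fintype.equivFin L
  let e' : (S → ℕ) → ℕ := fun x => if h : x ∈ L then e ⟨x, h⟩ else 0
  have he' : ∀ x, e' x < Fintype.card L := fun x => by
    by_cases h : x ∈ L
    · simp only [e', h, dif_pos, Fin.is_lt]
    · simp only [e', h, dif_neg, not_false_eq_true, Fintype.card_pos]
  have hee : ∀ x : L, e' x = e x := fun x => by simp [e']
  let p : (S → ℕ) → S → ℝ := fun x k => x k / N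
  have hN' : (0 : ℝ) < N := Nat.cast_pos.2 hN
  have hp : ∀ x ∈ L, p x ∈ stdSimplex ℝ S := fun x hx => by
    refine ⟨fun k => by positivity, ?_⟩
    rw [← sum_div, ← Nat.cast_sum, (hL x).1 hx, div_self hN'.ne']
  choose c hc using fun x : L => exists_max_image (univ : Finset S) (v (p x)) univ_nonempty
  obtain ⟨σ, hσ⟩ := exists_isDominant_image_eq
    (r := fun (i : S) (x : L) => x.1 i * Fintype.card L + e' x) (fun i x y hxy => by
      have := congrArg (· % Fintype.card L) hxy
      simp only [Nat.mul_add_mod_self_right, hee, Nat.mod_eq_of_lt (Fin.is_lt _)] at this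
      exact e.injective (Fin.ext this)) c
  obtain ⟨i, hi, -⟩ := hσ (Classical.arbitrary L)
  obtain ⟨x₀, hx₀, -⟩ := mem_image.1 hi
  obtain ⟨hout, hdiam⟩ := lattice_bounds (N := N) (K := Fintype.card L) e' he'
    (σ := σ.map (Function.Embedding.subtype _)) (C := σ.image c)
    (fun x hx => by
      obtain ⟨y, -, rfl⟩ := mem_map.1 hx
      exact (hL _).1 y.2)
    ⟨_, mem_map_of_mem _ hx₀⟩ (fun y hy => by
      obtain ⟨j, hj, hjx⟩ := hσ ⟨y, (hL y).2 hy⟩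
      refine ⟨j, hj, fun x hx => ?_⟩
      obtain ⟨z, hz, rfl⟩ := mem_map.1 hx
      exact hjx z hz)
  have hmem : ∀ x ∈ σ, (x : S → ℕ) ∈ σ.map (Function.Embedding.subtype _) := fun x hx =>
    mem_map_of_mem _ hx
  refine ⟨p x₀, hp _ x₀.2, fun s => ?_⟩
  by_cases hs : s ∈ σ.image c
  · right
    obtain ⟨z, hz, rfl⟩ := mem_image.1 hs
    refine ⟨p z, hp _ z.2, fun k => ?_, fun t => (hc z).2 t (mem_univ _)⟩
    have h₁ : ((z : S → ℕ) k : ℝ) ≤ (x₀ : S → ℕ) k + Fintype.card S := by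
      exact_mod_cast hdiam _ (hmem _ hx₀) _ (hmem _ hz) k
    have h₂ : ((x₀ : S → ℕ) k : ℝ) ≤ (z : S → ℕ) k + Fintype.card S := by
      exact_mod_cast hdiam _ (hmem _ hz) _ (hmem _ hx₀) k
    simp only [p]
    rw [← sub_div, abs_div, abs_of_pos hN']
    gcongr
    rw [abs_le]
    constructor <;> linarith
  · left
    simp only [p]
    gcongr
    exact_mod_cast hout _ (hmem _ hx₀) s hs

/-- A continuous payoff vector field on the simplex has a symmetric equilibrium: a point supported
on its own best replies. -/
theorem exists_population_equilibrium [Nonempty S] {v : (S → ℝ) → S → ℝ} (hv : Continuous v) :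
    ∃ x ∈ stdSimplex ℝ S, ∀ s, 0 < x s → ∀ t, v x t ≤ v x s := by
  choose x hx hxs using fun N : ℕ => exists_approximate_equilibrium v N.succ_pos
  obtain ⟨x', hx', φ, hφ, hlim⟩ := (isCompact_stdSimplex ℝ S).tendsto_subseq hx
  have hε : Filter.Tendsto (fun N : ℕ => (Fintype.card S : ℝ) / ((φ N).succ : ℕ)) Filter.atTop
      (nhds 0) :=
    ((tendsto_const_div_atTop_nhds_zero_nat (Fintype.card S : ℝ)).comp
      (Filter.tendsto_add_atTop_nat 1)).comp hφ.tendsto_atTop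
  refine ⟨x', hx', fun s hs t => ?_⟩
  have hev : ∀ᶠ N in Filter.atTop, ∃ z : S → ℝ,
      (∀ k, |z k - x (φ N) k| ≤ Fintype.card S / ((φ N).succ : ℕ)) ∧ v z t ≤ v z s := by
    have hlims : Filter.Tendsto (fun N => x (φ N) s) Filter.atTop (nhds (x' s)) :=
      (tendsto_pi_nhds.1 hlim) s
    filter_upwards [hε.eventually_lt hlims hs] with N hN
    obtain ⟨z, -, hz, hzs⟩ := (hxs (φ N) s).resolve_left (not_le.2 hN)
    exact ⟨z, hz, hzs t⟩
  choose! z hz using fun N (h : ∃ z : S → ℝ,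
    (∀ k, |z k - x (φ N) k| ≤ Fintype.card S / ((φ N).succ : ℕ)) ∧ v z t ≤ v z s) => h
  have hzlim : Filter.Tendsto z Filter.atTop (nhds x') := by
    rw [tendsto_pi_nhds]
    intro k
    have h₁ : Filter.Tendsto (fun N => z N k - x (φ N) k) Filter.atTop (nhds 0) :=
      squeeze_zero_norm' (hev.mono fun N hN => (hz N hN).1 k) hε
    simpa using h₁.add ((tendsto_pi_nhds.1 hlim) k)
  have hvz := fun s => (((continuous_apply s).comp hv).tendsto x').comp hzlim
  exact le_of_tendsto_of_tendsto (hvz t) (hvz s) (hev.mono fun N hN => (hz N hN).2)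

end Population

/-! ### Invariant Nash equilibria -/

section Nash

variable {I : Type*} {C : I → Type*} {u : ∀ i : I, (∀ j, C j) → ℝ} {G : Type*} [Group G]

namespace GameAction

/-- The permutation of the players induced by `g`. -/
def permI (A : GameAction G C u) (g : G) : Equiv.Perm I where
  toFun := A.actI g
  invFun := A.actI g⁻¹
  left_inv i := by rw [← A.actI_mul, inv_mul_cancel, A.actI_one]
  right_inv i := by rw [← A.actI_mul, mul_inv_cancel, A.actI_one]

/-- The permutation of the strategy profiles induced by `g`. -/
def permS (A : GameAction G C u) (g : G) : Equiv.Perm (∀ i, C i) where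
  toFun := A.actS g
  invFun := A.actS g⁻¹
  left_inv s := by rw [← A.actS_mul, inv_mul_cancel, A.actS_one]
  right_inv s := by rw [← A.actS_mul, mul_inv_cancel, A.actS_one]

theorem actS_apply_eq_iff (A : GameAction G C u) (g : G) (s t : ∀ i, C i) (i : I) :
    A.actS g s (A.actI g i) = A.actS g t (A.actI g i) ↔ s i = t i := by
  refine ⟨fun h => ?_, A.diagonal g s t i⟩
  have h' := A.diagonal g⁻¹ _ _ _ h
  rwa [← A.actS_mul, ← A.actS_mul, ← A.actI_mul, inv_mul_cancel, A.actS_one, A.actS_one,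
    A.actI_one] at h'

/-- A product distribution fixed by the action of `G`. -/
def IsInvariant (A : GameAction G C u) (ρ : ∀ i, C i → ℝ) : Prop :=
  ∀ g i s, ρ (A.actI g i) (A.actS g s (A.actI g i)) = ρ i (s i)

variable [Fintype I]

theorem IsInvariant.prod_actS {A : GameAction G C u} {ρ : ∀ i, C i → ℝ} (hρ : A.IsInvariant ρ)
    (g : G) (s : ∀ i, C i) : ∏ k, ρ k (A.actS g s k) = ∏ k, ρ k (s k) := by
  rw [← Equiv.prod_comp (A.permI g)]
  exact prod_congr rfl fun k _ => hρ g k s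

variable [∀ i, Fintype (C i)]

/-- Expected utility of player `i` playing `a` against the product distribution `ρ`. -/
noncomputable def _root_.expectedUtility (u : ∀ i : I, (∀ j, C j) → ℝ) (ρ : ∀ i, C i → ℝ) (i : I)
    (a : C i) : ℝ :=
  ∑ w, (∏ k, ρ k (w k)) * u i (Function.update w i a)

theorem IsInvariant.expectedUtility {A : GameAction G C u} {ρ : ∀ i, C i → ℝ}
    (hρ : A.IsInvariant ρ) : A.IsInvariant (expectedUtility u ρ) := by
  intro g i s
  unfold _root_.expectedUtility
  rw [← Equiv.sum_comp (A.permS g)]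
  refine sum_congr rfl fun w _ => ?_
  change (∏ k, ρ k (A.actS g w k)) * _ = _
  rw [hρ.prod_actS, ← A.utility_inv g i]
  congr 2
  funext k
  obtain ⟨k, rfl⟩ := (A.permI g).surjective k
  by_cases hk : k = i
  · subst hk
    change Function.update (A.permS g w) (A.actI g k) _ (A.actI g k) = _
    rw [Function.update_self]
    exact A.diagonal g _ _ k (Function.update_self _ _ _).symm
  · have hgk : A.actI g k ≠ A.actI g i := (A.permI g).injective.ne hk
    change Function.update (A.permS g w) (A.actI g i) _ (A.actI g k) = _
    rw [Function.update_of_ne hgk]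
    exact A.diagonal g _ _ k (Function.update_of_ne hk _ _).symm

/-- The marginals of the `G`-average of a distribution `x` on strategy profiles. -/
noncomputable def averageMarginal [Fintype G] (A : GameAction G C u) (x : (∀ i, C i) → ℝ) (i : I)
    (a : C i) : ℝ :=
  (∑ g, ∑ s, if A.actS g s i = a then x s else 0) / Fintype.card G

variable [Fintype G] (A : GameAction G C u)

theorem continuous_averageMarginal : Continuous A.averageMarginal := by
  refine continuous_pi fun i => continuous_pi fun a => Continuous.div_const ?_ _
  refine continuous_finsetSum _ fun g _ => continuous_finsetSum _ fun s _ => ?_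
  split_ifs <;> fun_prop

theorem averageMarginal_mem_stdSimplex {x : (∀ i, C i) → ℝ} (hx : x ∈ stdSimplex ℝ (∀ i, C i))
    (i : I) : A.averageMarginal x i ∈ stdSimplex ℝ (C i) := by
  refine ⟨fun a => div_nonneg (sum_nonneg fun g _ => sum_nonneg fun s _ => ?_)
    (Nat.cast_nonneg _), ?_⟩
  · split_ifs
    exacts [hx.1 s, le_rfl]
  · simp only [averageMarginal]
    rw [← sum_div, sum_comm]
    have : ∀ g : G, ∑ a, ∑ s, (if A.actS g s i = a then x s else 0) = 1 := fun g => by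
      rw [sum_comm, ← hx.2]
      exact sum_congr rfl fun s _ => by simp
    simp [this]

theorem averageMarginal_isInvariant (x : (∀ i, C i) → ℝ) :
    A.IsInvariant (A.averageMarginal x) := by
  intro h i t
  unfold averageMarginal
  congr 1
  rw [← Equiv.sum_comp (Equiv.mulLeft h)]
  refine sum_congr rfl fun g _ => sum_congr rfl fun s _ => ?_
  simp only [Equiv.coe_mulLeft, A.actS_mul, A.actS_apply_eq_iff]

theorem exists_of_averageMarginal_pos {x : (∀ i, C i) → ℝ} (hx : ∀ s, 0 ≤ x s) {i : I} {a : C i}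
    (h : 0 < A.averageMarginal x i a) : ∃ g s, 0 < x s ∧ A.actS g s i = a := by
  by_contra! hno
  refine h.ne' ?_
  unfold averageMarginal
  rw [sum_eq_zero, zero_div]
  refine fun g _ => sum_eq_zero fun s _ => ite_eq_right_iff.2 fun hs => ?_
  by_contra hne
  exact hno g s ((hx s).lt_of_ne' hne) hs

/-- Nash's theorem for games with symmetries: there is an invariant Nash equilibrium. -/
theorem exists_invariant_nash [∀ i, Nonempty (C i)] :
    ∃ ρ : ∀ i, C i → ℝ, (∀ i, ρ i ∈ stdSimplex ℝ (C i)) ∧ A.IsInvariant ρ ∧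
      ∀ i a, 0 < ρ i a → ∀ b, expectedUtility u ρ i b ≤ expectedUtility u ρ i a := by
  have hcont : Continuous fun (x : (∀ i, C i) → ℝ) (s : ∀ i, C i) =>
      ∑ i, expectedUtility u (A.averageMarginal x) i (s i) := by
    have := A.continuous_averageMarginal
    unfold expectedUtility
    fun_prop
  obtain ⟨x, hx, hopt⟩ := exists_population_equilibrium hcont
  have hinv := A.averageMarginal_isInvariant x
  refine ⟨A.averageMarginal x, A.averageMarginal_mem_stdSimplex hx, hinv, fun i a ha b => ?_⟩
  obtain ⟨g, s, hs, rfl⟩ := A.exists_of_averageMarginal_pos hx.1 ha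
  have hle := hopt s hs (Function.update (A.actS g s) i b)
  have hsum : ∑ k, expectedUtility u (A.averageMarginal x) k (A.actS g s k) =
      ∑ k, expectedUtility u (A.averageMarginal x) k (s k) := by
    rw [← Equiv.sum_comp (A.permI g)]
    exact sum_congr rfl fun k _ => hinv.expectedUtility g k s
  by_contra! hlt
  refine absurd (hle.trans hsum.ge) (not_le.2 (sum_lt_sum (fun k _ => ?_) ⟨i, mem_univ _, ?_⟩))
  · by_cases hk : k = i
    · subst hk
      rw [Function.update_self]
      exact hlt.le
    · rw [Function.update_of_ne hk]
  · rwa [Function.update_self]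

end GameAction

end Nash

/-! ### Powers of an invariant Nash equilibrium -/

section Power

theorem Fintype.sum_prod_apply {J : Type*} [Fintype J] [DecidableEq J] {B : J → Type*}
    [∀ k, Fintype (B k)]
    (h : ∀ k, B k → ℝ) : ∑ s : ∀ k, B k, ∏ k, h k (s k) = ∏ k, ∑ b, h k b := by
  rw [prod_univ_sum, Fintype.piFinset_univ]

theorem prod_mem_stdSimplex {J : Type*} [Fintype J] [DecidableEq J] {B : J → Type*}
    [∀ k, Fintype (B k)]
    {p : ∀ k, B k → ℝ} (hp : ∀ k, p k ∈ stdSimplex ℝ (B k)) :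
    (fun s : ∀ k, B k => ∏ k, p k (s k)) ∈ stdSimplex ℝ (∀ k, B k) :=
  ⟨fun s => prod_nonneg fun k _ => (hp k).1 _, by
    rw [Fintype.sum_prod_apply, prod_congr rfl fun k _ => (hp k).2, prod_const_one]⟩

/-- The image of a product measure under a product map is a product measure. -/
theorem sum_prod_mul_comp {J : Type*} [Fintype J] [DecidableEq J] {B D : J → Type*}
    [∀ k, Fintype (B k)] [∀ k, Fintype (D k)] (h : ∀ k, B k → ℝ) (φ : ∀ k, B k → D k) (F : (∀ k, D k) → ℝ) :
    ∑ s : ∀ k, B k, (∏ k, h k (s k)) * F (fun k => φ k (s k)) =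
      ∑ w, (∏ k, ∑ b, if φ k b = w k then h k b else 0) * F w := by
  simp_rw [← Fintype.sum_prod_apply, sum_mul]
  rw [sum_comm]
  refine sum_congr rfl fun s _ => ?_
  rw [Fintype.sum_eq_single fun k => φ k (s k)]
  · simp
  · intro w hw
    obtain ⟨k, hk⟩ := Function.ne_iff.1 hw
    rw [prod_eq_zero (mem_univ k) (if_neg (Ne.symm hk)), zero_mul]

theorem sum_ite_prod_eq_apply {J B : Type*} [Fintype J] [DecidableEq J] [Fintype B] {p : B → ℝ}
    (hp : ∑ b, p b = 1) (j : J) (w : B) :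
    (∑ a : J → B, if a j = w then ∏ l, p (a l) else 0) = p w := by
  have h : ∀ a : J → B, (if a j = w then ∏ l, p (a l) else 0) =
      ∏ l, if l = j → a l = w then p (a l) else 0 := by
    intro a
    split_ifs with ha
    · refine prod_congr rfl fun l _ => (if_pos ?_).symm
      rintro rfl
      exact ha
    · refine (prod_eq_zero (mem_univ j) (if_neg fun h => ha (h rfl))).symm
  simp_rw [h]
  rw [Fintype.sum_prod_apply (fun l b => if l = j → b = w then p b else 0),
    Fintype.prod_eq_single j fun l hl => by simp [hl, hp]]
  simp

variable {I : Type*} [Fintype I] {C : I → Type*}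

theorem prod_mem_powInv {G : Type*} [Group G] {u : ∀ i : I, (∀ j, C j) → ℝ}
    {A : GameAction G C u} {ρ : ∀ i, C i → ℝ} (hρ : A.IsInvariant ρ) (m : ℕ) :
    (fun s : ∀ k, Fin m → C k => ∏ k, ∏ l, ρ k (s k l)) ∈ powInv A m := by
  intro g σ
  funext s
  change ∏ k, ∏ l, ρ k (A.actS g (fun k' => s k' (σ⁻¹ l)) k) = _
  rw [prod_comm, prod_congr rfl fun l _ => hρ.prod_actS g fun k' => s k' (σ⁻¹ l),
    Equiv.prod_comp σ⁻¹ fun l => ∏ k, ρ k (s k l), prod_comm]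

variable [∀ i, Fintype (C i)]

theorem sum_ite_update_mul_prod (u : ∀ i : I, (∀ j, C j) → ℝ) {ρ : ∀ i, C i → ℝ}
    (hρ : ∀ i, ∑ a, ρ i a = 1) {m : ℕ} (i : I) (r : Fin m → C i) (j : Fin m) (b : C i) :
    (∑ s : ∀ k, Fin m → C k, if s i = r then
      u i (Function.update (fun k => s k j) i b) * ∏ k, ∏ l, ρ k (s k l) else 0) =
      (∏ l, ρ i (r l)) * expectedUtility u ρ i b := by
  let h : ∀ k, (Fin m → C k) → ℝ :=
    Function.update (fun k a => ∏ l, ρ k (a l)) i fun a => if a = r then ∏ l, ρ i (a l) else 0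
  let φ : ∀ k, (Fin m → C k) → C k := Function.update (fun k a => a j) i fun _ => b
  let ψ : ∀ k, C k → C k := Function.update (fun k a => a) i fun _ => b
  have hφ : ∀ s : ∀ k, Fin m → C k,
      (fun k => φ k (s k)) = Function.update (fun k => s k j) i b := by
    intro s
    funext k
    by_cases hk : k = i
    · subst hk; simp [φ]
    · simp [φ, hk]
  have hψ : ∀ w : ∀ k, C k, (fun k => ψ k (w k)) = Function.update w i b := by
    intro w
    funext k
    by_cases hk : k = i
    · subst hk; simp [ψ]
    · simp [ψ, hk]
  have hh : ∀ s : ∀ k, Fin m → C k,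
      ∏ k, h k (s k) = if s i = r then ∏ k, ∏ l, ρ k (s k l) else 0 := by
    intro s
    split_ifs with hs
    · refine prod_congr rfl fun k _ => ?_
      by_cases hk : k = i
      · subst hk; simp [h, hs]
      · simp [h, hk]
    · exact prod_eq_zero (mem_univ i) (by simp [h, hs])
  have hl := sum_prod_mul_comp h φ (u i)
  have hr := sum_prod_mul_comp ρ ψ (u i)
  simp_rw [hφ, hh] at hl
  simp_rw [hψ] at hr
  unfold expectedUtility
  rw [hr, mul_sum]
  refine Eq.trans (sum_congr rfl fun s _ => ?_) (hl.trans (sum_congr rfl fun w _ => ?_))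
  · split_ifs <;> ring
  rw [← mul_assoc]
  congr 1
  rw [← mul_prod_erase univ _ (mem_univ i),
    ← mul_prod_erase univ (fun k => ∑ b, if ψ k b = w k then ρ k b else 0) (mem_univ i),
    ← mul_assoc]
  congr 1
  · by_cases hb : b = w i <;> simp [φ, ψ, h, hb, hρ]
  · refine prod_congr rfl fun k hk => ?_
    have hk := ne_of_mem_erase hk
    simp [φ, ψ, h, hk, sum_ite_prod_eq_apply (hρ k)]

theorem prod_mem_ceTen {u : ∀ i : I, (∀ j, C j) → ℝ} {ρ : ∀ i, C i → ℝ}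
    (hρ : ∀ i, ρ i ∈ stdSimplex ℝ (C i))
    (hnash : ∀ i a, 0 < ρ i a → ∀ b, expectedUtility u ρ i b ≤ expectedUtility u ρ i a) (m : ℕ) :
    (fun s : ∀ k, Fin m → C k => ∏ k, ∏ l, ρ k (s k l)) ∈ ceTen u m := by
  refine ⟨prod_mem_stdSimplex (p := fun k (a : Fin m → C k) => ∏ l, ρ k (a l)) fun k =>
    prod_mem_stdSimplex (p := fun _ => ρ k) fun _ => hρ k, fun i r t => ?_⟩
  have hterm : ∀ s : ∀ k, Fin m → C k,
      (if s i = r then (uTen u m i (Function.update s i t) - uTen u m i s) *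
        ∏ k, ∏ l, ρ k (s k l) else 0) =
      ∑ j, ((if s i = r then u i (Function.update (fun k => s k j) i (t j)) *
          ∏ k, ∏ l, ρ k (s k l) else 0) -
        if s i = r then u i (Function.update (fun k => s k j) i (r j)) *
          ∏ k, ∏ l, ρ k (s k l) else 0) := by
    intro s
    split_ifs with hs
    · simp only [uTen]
      rw [← sum_sub_distrib, sum_mul]
      refine sum_congr rfl fun j _ => ?_
      rw [sub_mul]
      congr 4
      · funext k
        by_cases hk : k = i
        · subst hk; simp
        · simp [hk]
      · funext k
        by_cases hk : k = i
        · subst hk; simp [hs]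
        · simp [hk]
    · simp
  simp_rw [hterm]
  rw [sum_comm]
  refine sum_nonpos fun j _ => ?_
  rw [sum_sub_distrib, sum_ite_update_mul_prod u (fun i => (hρ i).2),
    sum_ite_update_mul_prod u (fun i => (hρ i).2), ← mul_sub]
  rcases ((hρ i).1 (r j)).eq_or_lt with h0 | hpos
  · rw [prod_eq_zero (mem_univ j) h0.symm, zero_mul]
  · exact mul_nonpos_of_nonneg_of_nonpos (prod_nonneg fun l _ => (hρ i).1 _)
      (sub_nonpos.2 (hnash i _ hpos _))

end Power

/-- A game with a finite symmetry group `G` has an order `m` `G`-exchangeable equilibrium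
for every `m`: the set `XE_G^m(Γ) = Δ^X_{G×S_m}(Γ^{Πm}) ∩ CE_{G×S_m}(Γ^{⊗m})` is
nonempty. -/
theorem order_m_exchangeable_equilibrium_exists
    {G : Type*} [Group G] [Fintype G]
    {I : Type*} [Fintype I] {C : I → Type*} [∀ i, Fintype (C i)]
    (hI : 2 ≤ Fintype.card I) (hC : ∀ i, 2 ≤ Fintype.card (C i))
    (u : ∀ i : I, (∀ j, C j) → ℝ) (A : GameAction G C u) (m : ℕ) :
    (convexHull ℝ (prodPow C m ∩ powInv A m) ∩
      (ceTen u m ∩ powInv A m)).Nonempty := by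
  have : ∀ i, Nonempty (C i) := fun i => Fintype.card_pos_iff.1 (two_pos.trans_le (hC i))
  obtain ⟨ρ, hρ, hinv, hnash⟩ := A.exists_invariant_nash
  have hpow := prod_mem_powInv hinv m
  exact ⟨_, subset_convexHull ℝ _ ⟨⟨fun i _ => ρ i, fun i _ => hρ i, rfl⟩, hpow⟩,
    prod_mem_ceTen hρ hnash m, hpow⟩
end
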